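/- Let u be a Lipschitz solution of the boundary (Signorini) obstacle problem in B₁⁺ with F, F₀ satisfying (H0) and (H1). Then for every z₀ ∈ Γ(u), the one-sided normal derivative ∂_{n+1}u(z₀) := lim_{t→0⁺} u(z₀ + t·e_{n+1})/t exists and the (n+1)-st component of F satisfies F_{n+1}(z₀, 0, (0, ∂_{n+1}u(z₀))) = 0. -/

import Mathlib

open MeasureTheory Metric Filter
open scoped InnerProductSpace NNReal ENNReal Topology

noncomputable section

/-- Euclidean space `ℝ^{n+1}`. -/
abbrev Eucl (n : ℕ) : Type := EuclideanSpace ℝ (Fin (n + 1))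

namespace TOP

variable {n : ℕ}

/-- The `(n+1)`-st standard basis vector `e_{n+1}`. -/
def eLast (n : ℕ) : Eucl n := EuclideanSpace.single (Fin.last n) 1

/-- Open upper half ball `B_r⁺(x₀)`. -/
def hBall (x₀ : Eucl n) (r : ℝ) : Set (Eucl n) :=
  Metric.ball x₀ r ∩ {x : Eucl n | 0 < x (Fin.last n)}

/-- Open lower half ball `B_r⁻(x₀)`. -/
def hBallNeg (x₀ : Eucl n) (r : ℝ) : Set (Eucl n) :=
  Metric.ball x₀ r ∩ {x : Eucl n | x (Fin.last n) < 0}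

/-- Thin ball `B_r'(x₀)`. -/
def tBall (x₀ : Eucl n) (r : ℝ) : Set (Eucl n) :=
  Metric.ball x₀ r ∩ {x : Eucl n | x (Fin.last n) = 0}

/-- (H0): `F` and `F₀` are of class `C¹` on `B₁ × ℝ × ℝ^{n+1}`. -/
def H0 (F : Eucl n → ℝ → Eucl n → Eucl n) (F₀ : Eucl n → ℝ → Eucl n → ℝ) : Prop :=
  ContDiffOn ℝ 1 (fun q : Eucl n × ℝ × Eucl n => F q.1 q.2.1 q.2.2)
      (Metric.ball (0 : Eucl n) 1 ×ˢ (Set.univ : Set ℝ) ×ˢ (Set.univ : Set (Eucl n))) ∧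
    ContDiffOn ℝ 1 (fun q : Eucl n × ℝ × Eucl n => F₀ q.1 q.2.1 q.2.2)
      (Metric.ball (0 : Eucl n) 1 ×ˢ (Set.univ : Set ℝ) ×ˢ (Set.univ : Set (Eucl n)))

/-- (H1): uniform ellipticity of `D_pF` on compact subsets. -/
def H1 (F : Eucl n → ℝ → Eucl n → Eucl n) : Prop :=
  ∀ M : ℝ, 0 < M → ∃ lam : ℝ, 0 < lam ∧
    ∀ x ∈ Metric.ball (0 : Eucl n) 1, ∀ z : ℝ, |z| ≤ M → ∀ p : Eucl n, ‖p‖ ≤ M →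
      ∀ ξ : Eucl n, lam * ‖ξ‖ ^ 2 ≤ ⟪fderiv ℝ (F x z) p ξ, ξ⟫_ℝ

/-- (H1) with a prescribed ellipticity function `lam : M ↦ λ(M)`. -/
def H1With (lam : ℝ → ℝ) (F : Eucl n → ℝ → Eucl n → Eucl n) : Prop :=
  ∀ M : ℝ, 0 < M → 0 < lam M ∧
    ∀ x ∈ Metric.ball (0 : Eucl n) 1, ∀ z : ℝ, |z| ≤ M → ∀ p : Eucl n, ‖p‖ ≤ M →
      ∀ ξ : Eucl n, lam M * ‖ξ‖ ^ 2 ≤ ⟪fderiv ℝ (F x z) p ξ, ξ⟫_ℝ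

/-- `div_x F (x, z, p) = ∑ᵢ ∂_{xᵢ} Fᵢ (x, z, p)`. -/
def divx (F : Eucl n → ℝ → Eucl n → Eucl n) (x : Eucl n) (z : ℝ) (p : Eucl n) : ℝ :=
  ∑ i : Fin (n + 1), fderiv ℝ (fun y : Eucl n => F y z p i) x (EuclideanSpace.single i 1)

/-- `(F, F₀)` is `t`-rescaled with bound function `L : M ↦ L(M)`. -/
def Rescaled (t : ℝ) (L : ℝ → ℝ) (F : Eucl n → ℝ → Eucl n → Eucl n)
    (F₀ : Eucl n → ℝ → Eucl n → ℝ) : Prop :=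
  ∀ M : ℝ, 0 < M → ∀ x ∈ Metric.ball (0 : Eucl n) 1, ∀ z : ℝ, |z| ≤ M →
    ∀ p : Eucl n, ‖p‖ ≤ M →
      |(- divx F x z p - ⟪deriv (fun s : ℝ => F x s p) z, p⟫_ℝ + F₀ x z p)| ≤ t * L M ∧
        ‖fderiv ℝ (F x z) p‖ ≤ L M

/-- The operator `H_t` acting classically on a `C²` function `φ`:
`H_t(φ)(x) = −div_x F − ⟨∂_z F, ∇φ⟩ − tr(D_pF · D²φ) + F₀`, all evaluated at
`(x, φ(x), ∇φ(x))`. -/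
def Hop (F : Eucl n → ℝ → Eucl n → Eucl n) (F₀ : Eucl n → ℝ → Eucl n → ℝ)
    (φ : Eucl n → ℝ) (x : Eucl n) : ℝ :=
  - divx F x (φ x) (gradient φ x)
    - ⟪deriv (fun s : ℝ => F x s (gradient φ x)) (φ x), gradient φ x⟫_ℝ
    - ∑ i : Fin (n + 1),
        ⟪fderiv ℝ (F x (φ x)) (gradient φ x)
          (fderiv ℝ (gradient φ) x (EuclideanSpace.single i 1)), EuclideanSpace.single i 1⟫_ℝ
    + F₀ x (φ x) (gradient φ x)

/-- The admissible class `A_g` for the thin obstacle problem: `W^{1,∞}(B₁)` functions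
with boundary value `g` on `∂B₁` which are nonnegative on `B₁'`. -/
def AdmissibleThin (g v : Eucl n → ℝ) : Prop :=
  (∃ C : ℝ≥0, LipschitzOnWith C v (Metric.closedBall (0 : Eucl n) 1)) ∧
    (∀ x ∈ Metric.sphere (0 : Eucl n) 1, v x = g x) ∧
    ∀ x ∈ tBall (0 : Eucl n) 1, 0 ≤ v x

/-- A (Lipschitz) solution of the thin obstacle problem in `B₁`. -/
def ThinSolution (F : Eucl n → ℝ → Eucl n → Eucl n) (F₀ : Eucl n → ℝ → Eucl n → ℝ)
    (g u : Eucl n → ℝ) : Prop :=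
  AdmissibleThin g u ∧
    ∀ v : Eucl n → ℝ, AdmissibleThin g v →
      0 ≤ ∫ x in Metric.ball (0 : Eucl n) 1,
        (⟪F x (u x) (gradient u x), gradient v x - gradient u x⟫_ℝ +
          F₀ x (u x) (gradient u x) * (v x - u x))

/-- The admissible class `A_g` for the boundary (Signorini) obstacle problem:
`W^{1,∞}(B₁⁺)` functions with boundary value `g` on `∂B₁⁺ ∖ B₁'` which are
nonnegative on `B₁'`. -/
def AdmissibleBdry (g v : Eucl n → ℝ) : Prop :=
  (∃ C : ℝ≥0, LipschitzOnWith C v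
      (Metric.closedBall (0 : Eucl n) 1 ∩ {x : Eucl n | 0 ≤ x (Fin.last n)})) ∧
    (∀ x : Eucl n, ‖x‖ = 1 → 0 ≤ x (Fin.last n) → v x = g x) ∧
    ∀ x ∈ tBall (0 : Eucl n) 1, 0 ≤ v x

/-- A (Lipschitz) solution of the boundary (Signorini) obstacle problem in `B₁⁺`. -/
def BdrySolution (F : Eucl n → ℝ → Eucl n → Eucl n) (F₀ : Eucl n → ℝ → Eucl n → ℝ)
    (g u : Eucl n → ℝ) : Prop :=
  AdmissibleBdry g u ∧
    ∀ v : Eucl n → ℝ, AdmissibleBdry g v →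
      0 ≤ ∫ x in hBall (0 : Eucl n) 1,
        (⟪F x (u x) (gradient u x), gradient v x - gradient u x⟫_ℝ +
          F₀ x (u x) (gradient u x) * (v x - u x))

/-- The coincidence set `Λ(u) = {x ∈ B₁' : u(x) = 0}`. -/
def coincidenceSet (u : Eucl n → ℝ) : Set (Eucl n) :=
  {x ∈ tBall (0 : Eucl n) 1 | u x = 0}

/-- The free boundary `Γ(u)`: the boundary of `Λ(u)` in the relative topology of `B₁'`. -/
def freeBoundary (u : Eucl n → ℝ) : Set (Eucl n) :=
  {x ∈ coincidenceSet u |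
    ∀ r : ℝ, 0 < r → ∃ y ∈ tBall (0 : Eucl n) 1, y ∈ Metric.ball x r ∧ 0 < u y}

/-- `w` satisfies the Caccioppoli inequality with constant `Q` at `x₀ ∈ B₁'`. -/
def CaccAt (w : Eucl n → ℝ) (Q : ℝ) (x₀ : Eucl n) : Prop :=
  ∀ k : ℝ, 0 ≤ k → ∀ r R : ℝ, 0 < r → r < R → R < 1 - ‖x₀‖ →
    (∫ x in ({x : Eucl n | k ≤ w x} ∩ hBall x₀ r), ‖gradient w x‖ ^ 2) ≤
      Q / (R - r) ^ 2 * (∫ x in ({x : Eucl n | k ≤ w x} ∩ hBall x₀ R), (w x - k) ^ 2) +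
        Q * (volume ({x : Eucl n | k ≤ w x} ∩ hBall x₀ R)).toReal

/-- Difference quotient `D_e^h w (x) = (w(x + h e) − w(x))/h`. -/
def diffQuot (h : ℝ) (e : Eucl n) (w : Eucl n → ℝ) (x : Eucl n) : ℝ :=
  (w (x + h • e) - w x) / h

/-- The barrier function `η(x) = t(|x' − x₀'|² − K x_{n+1}²) + m x_{n+1} + γ`. -/
def etaFn (x₀ : Eucl n) (t K m γ : ℝ) (x : Eucl n) : ℝ :=
  t * ((∑ i : Fin n, (x i.castSucc - x₀ i.castSucc) ^ 2) - K * (x (Fin.last n)) ^ 2) +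
    m * x (Fin.last n) + γ

end TOP

namespace TOP

variable {n : ℕ}

lemma abs_last_sub_le (x y : Eucl n) : |x (Fin.last n) - y (Fin.last n)| ≤ dist x y := by
  have := PiLp.norm_apply_le (p := 2) (x - y) (Fin.last n)
  rw [dist_eq_norm]
  simpa using this

lemma continuous_last : Continuous fun x : Eucl n => x (Fin.last n) := by fun_prop

lemma measurableSet_upper : MeasurableSet {x : Eucl n | 0 < x (Fin.last n)} :=
  (isOpen_lt continuous_const continuous_last).measurableSet

/-- The ramp `min(1, k · x_{n+1}⁺)`, increasing to the indicator of the open upper half-space. -/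
def ramp (k : ℕ) (x : Eucl n) : ℝ := min 1 (k * max (x (Fin.last n)) 0)

lemma lipschitzWith_ramp (k : ℕ) : LipschitzWith k (ramp k : Eucl n → ℝ) := by
  refine LipschitzWith.of_le_add_mul _ fun x y => ?_
  have h := abs_le.1 (abs_last_sub_le x y)
  have hk : (0 : ℝ) ≤ k := by positivity
  have h1 : max (x (Fin.last n)) 0 ≤ max (y (Fin.last n)) 0 + dist x y :=
    max_le (by linarith [le_max_left (y (Fin.last n)) 0])
      (add_nonneg (le_max_right _ _) dist_nonneg)
  have h2 : (k : ℝ) * max (x (Fin.last n)) 0 ≤ k * max (y (Fin.last n)) 0 + k * dist x y := by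
    rw [← mul_add]; gcongr
  have h3 : 0 ≤ (k : ℝ) * dist x y := by positivity
  simp only [ramp, NNReal.coe_natCast]
  rcases min_cases 1 ((k : ℝ) * max (y (Fin.last n)) 0) with h4 | h4
  · exact (min_le_left _ _).trans (by linarith)
  · exact (min_le_right _ _).trans (by linarith)

lemma ramp_nonneg (k : ℕ) (x : Eucl n) : 0 ≤ ramp k x :=
  le_min zero_le_one (by positivity)

lemma ramp_le_one (k : ℕ) (x : Eucl n) : ramp k x ≤ 1 := min_le_left _ _

lemma lineDeriv_ramp_tangential (k : ℕ) (x : Eucl n) {i : Fin (n + 1)} (hi : i ≠ Fin.last n) :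
    lineDeriv ℝ (ramp k) x (EuclideanSpace.single i 1) = 0 := by
  have : (fun t : ℝ => ramp k (x + t • EuclideanSpace.single i (1 : ℝ))) = fun _ => ramp k x := by
    funext t
    simp [ramp, hi.symm]
  simp [lineDeriv, this]

lemma lineDeriv_ramp_nonneg (k : ℕ) (x : Eucl n) :
    0 ≤ lineDeriv ℝ (ramp k) x (EuclideanSpace.single (Fin.last n) 1) := by
  refine Monotone.deriv_nonneg fun s t hst => ?_
  simp only [ramp, PiLp.add_apply, PiLp.smul_apply, PiLp.single_apply]
  gcongr

lemma lineDeriv_ramp_le (k : ℕ) (x : Eucl n) :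
    lineDeriv ℝ (ramp k) x (EuclideanSpace.single (Fin.last n) 1) ≤ k := by
  have := norm_lineDeriv_le_of_lipschitz ℝ (lipschitzWith_ramp k) (x₀ := x)
    (v := EuclideanSpace.single (Fin.last n) (1 : ℝ))
  simpa using (le_abs_self _).trans this

lemma lineDeriv_ramp_of_neg (k : ℕ) {x : Eucl n} (hx : x (Fin.last n) < 0) (v : Eucl n) :
    lineDeriv ℝ (ramp k) x v = 0 := by
  have : ramp k =ᶠ[𝓝 x] fun _ => (0 : ℝ) := by
    filter_upwards [(isOpen_lt continuous_last continuous_const).mem_nhds hx] with y hy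
    simp [ramp, max_eq_right (le_of_lt hy)]
  rw [this.lineDeriv_eq]; simp [lineDeriv]

lemma lineDeriv_ramp_of_one_lt (k : ℕ) {x : Eucl n} (hx : 1 < k * x (Fin.last n)) (v : Eucl n) :
    lineDeriv ℝ (ramp k) x v = 0 := by
  have : ramp k =ᶠ[𝓝 x] fun _ => (1 : ℝ) := by
    filter_upwards [(isOpen_lt continuous_const
      (continuous_last.const_mul (k : ℝ))).mem_nhds hx] with y hy
    have hy' : 1 < (k : ℝ) * y (Fin.last n) := hy
    have : (k : ℝ) * y (Fin.last n) ≤ k * max (y (Fin.last n)) 0 := by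
      gcongr; exact le_max_left _ _
    simp only [ramp]
    exact min_eq_left (by linarith)
  rw [this.lineDeriv_eq]; simp [lineDeriv]

lemma tendsto_ramp (x : Eucl n) :
    Tendsto (fun k : ℕ => ramp k x) atTop
      (𝓝 (Set.indicator {x : Eucl n | 0 < x (Fin.last n)} 1 x)) := by
  by_cases hx : 0 < x (Fin.last n)
  · have : ∀ᶠ k : ℕ in atTop, ramp k x = 1 := by
      obtain ⟨N, hN⟩ := exists_nat_gt (1 / x (Fin.last n))
      filter_upwards [eventually_ge_atTop N] with k hk
      have hk' : (N : ℝ) ≤ k := by exact_mod_cast hk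
      rw [ramp, max_eq_left hx.le]
      rw [div_lt_iff₀ hx] at hN
      exact min_eq_left (hN.le.trans (by gcongr))
    rw [Set.indicator_of_mem (by exact hx)]
    exact tendsto_const_nhds.congr' (this.mono fun k hk => by simp [hk])
  · rw [Set.indicator_of_notMem (by exact hx)]
    have : ∀ k : ℕ, ramp k x = 0 := fun k => by simp [ramp, max_eq_right (not_lt.1 hx)]
    simp [this]

lemma integrable_lineDeriv_of_hasCompactSupport {K : ℝ≥0} {f : Eucl n → ℝ}
    (hf : LipschitzWith K f) (hc : HasCompactSupport f) (v : Eucl n) :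
    Integrable fun x => lineDeriv ℝ f x v := by
  have hzero : ∀ x ∉ tsupport f, lineDeriv ℝ f x v = 0 := by
    intro x hx
    have : f =ᶠ[𝓝 x] fun _ => (0 : ℝ) := notMem_tsupport_iff_eventuallyEq.1 hx
    rw [this.lineDeriv_eq]; simp [lineDeriv]
  have : IntegrableOn (fun x => lineDeriv ℝ f x v) (tsupport f) :=
    (hf.locallyIntegrable_lineDeriv v).integrableOn_isCompact hc
  exact (integrableOn_iff_integrable_of_support_subset fun x hx => by
    by_contra h; exact hx (hzero x h)).1 this

/-- Divergence inequality on the half-space for Lipschitz vector fields with compact support whose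
inward component is nonnegative on the boundary hyperplane. -/
lemma integral_divergence_nonpos {Y : Fin (n + 1) → Eucl n → ℝ} {K : ℝ≥0}
    (hY : ∀ i, LipschitzWith K (Y i)) (hc : ∀ i, HasCompactSupport (Y i)) {C : ℝ} (hC : 0 ≤ C)
    (hb : ∀ x : Eucl n, 0 ≤ x (Fin.last n) → -C * x (Fin.last n) ≤ Y (Fin.last n) x) :
    ∫ x in {x : Eucl n | 0 < x (Fin.last n)},
      ∑ i, lineDeriv ℝ (Y i) x (EuclideanSpace.single i 1) ≤ 0 := by
  set D : Eucl n → ℝ := fun x => ∑ i, lineDeriv ℝ (Y i) x (EuclideanSpace.single i 1) with hD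
  have hint : ∀ i, Integrable fun x => lineDeriv ℝ (Y i) x (EuclideanSpace.single i 1) := fun i =>
    integrable_lineDeriv_of_hasCompactSupport (hY i) (hc i) _
  have hDint : Integrable D := integrable_finsetSum _ fun i _ => hint i
  have hrc : ∀ k : ℕ, Continuous (ramp k : Eucl n → ℝ) := fun k => (lipschitzWith_ramp k).continuous
  have hmul : ∀ (k : ℕ) (f : Eucl n → ℝ), Integrable f → Integrable fun x => f x * ramp k x :=
    fun k f hf => hf.mul_bdd (c := 1) (hrc k).aestronglyMeasurable
      (Eventually.of_forall fun x => by
        rw [Real.norm_of_nonneg (ramp_nonneg k x)]; exact ramp_le_one k x)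
  have hlim1 : Tendsto (fun k : ℕ => ∫ x, D x * ramp k x) atTop
      (𝓝 (∫ x in {x : Eucl n | 0 < x (Fin.last n)}, D x)) := by
    rw [← integral_indicator measurableSet_upper]
    refine tendsto_integral_of_dominated_convergence (fun x => ‖D x‖)
      (fun k => (hmul k D hDint).aestronglyMeasurable) hDint.norm (fun k => ?_) ?_
    · refine Eventually.of_forall fun x => ?_
      rw [norm_mul, Real.norm_of_nonneg (ramp_nonneg k x)]
      exact mul_le_of_le_one_right (norm_nonneg _) (ramp_le_one k x)
    · refine Eventually.of_forall fun x => ?_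
      have := (tendsto_ramp x).const_mul (D x)
      convert this using 2
      by_cases hx : 0 < x (Fin.last n) <;> simp [Set.indicator, hx]
  set S : Set (Eucl n) := tsupport (Y (Fin.last n)) with hS
  have hSc : IsCompact S := hc _
  set A : ℕ → Set (Eucl n) := fun k =>
    S ∩ {x | 0 < x (Fin.last n) ∧ (k : ℝ) * x (Fin.last n) ≤ 1} with hA
  have hAm : ∀ k, MeasurableSet (A k) := fun k => hSc.measurableSet.inter
    (measurableSet_upper.inter
      (isClosed_le (continuous_last.const_mul _) continuous_const).measurableSet)
  have hlim2 : Tendsto (fun k : ℕ => ∫ x, (A k).indicator (fun _ => C) x) atTop (𝓝 0) := by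
    have : (0 : ℝ) = ∫ _ : Eucl n, (0 : ℝ) := by simp
    rw [this]
    refine tendsto_integral_of_dominated_convergence (S.indicator fun _ => C)
      (fun k => (measurable_const.indicator (hAm k)).aestronglyMeasurable)
      ((integrable_indicator_iff hSc.measurableSet).2
        (integrableOn_const hSc.measure_lt_top.ne)) (fun k => ?_) ?_
    · refine Eventually.of_forall fun x => ?_
      by_cases hx : x ∈ A k
      · rw [Set.indicator_of_mem hx, Set.indicator_of_mem hx.1, Real.norm_of_nonneg hC]
      · rw [Set.indicator_of_notMem hx, norm_zero]
        exact Set.indicator_nonneg (fun _ _ => hC) x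
    · refine Eventually.of_forall fun x => ?_
      have : ∀ᶠ k : ℕ in atTop, (A k).indicator (fun _ => C) x = 0 := by
        by_cases hx : 0 < x (Fin.last n)
        · obtain ⟨N, hN⟩ := exists_nat_gt (1 / x (Fin.last n))
          filter_upwards [eventually_ge_atTop N] with k hk
          have hk' : (N : ℝ) ≤ k := by exact_mod_cast hk
          refine Set.indicator_of_notMem (fun h => ?_) _
          rw [div_lt_iff₀ hx] at hN
          have := h.2.2
          nlinarith
        · exact Eventually.of_forall fun k => Set.indicator_of_notMem (fun h => hx h.2.1) _
      exact tendsto_const_nhds.congr' (this.mono fun k hk => hk.symm)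
  refine le_of_tendsto_of_tendsto' hlim1 hlim2 fun k => ?_
  have hparts : ∀ i, ∫ x, lineDeriv ℝ (Y i) x (EuclideanSpace.single i 1) * ramp k x =
      ∫ x, - (lineDeriv ℝ (ramp k) x (EuclideanSpace.single i 1) * Y i x) := by
    intro i
    rw [integral_neg, (lipschitzWith_ramp k).integral_lineDeriv_mul_eq (hY i) (hc i)]
    simp only [lineDeriv_neg, neg_mul, integral_neg, neg_neg]
  have hsum : ∫ x, D x * ramp k x =
      ∫ x, - (lineDeriv ℝ (ramp k) x (EuclideanSpace.single (Fin.last n) 1) *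
        Y (Fin.last n) x) := by
    simp only [hD, Finset.sum_mul]
    rw [integral_finsetSum _ fun i _ => hmul k _ (hint i), Finset.sum_congr rfl fun i _ => hparts i]
    refine Finset.sum_eq_single _ (fun i _ hi => ?_) (by simp)
    simp [lineDeriv_ramp_tangential k _ hi]
  rw [hsum]
  have hYi : Integrable (Y (Fin.last n)) :=
    (hY _).continuous.integrable_of_hasCompactSupport (hc _)
  refine integral_mono (Integrable.neg ?_) ((integrable_indicator_iff (hAm k)).2
    (integrableOn_const ((measure_mono Set.inter_subset_left).trans_lt hSc.measure_lt_top).ne))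
    fun x => ?_
  · refine hYi.bdd_mul (c := k) (measurable_lineDeriv (hrc k)).aestronglyMeasurable
      (Eventually.of_forall fun x => ?_)
    rw [Real.norm_of_nonneg (lineDeriv_ramp_nonneg k x)]
    exact lineDeriv_ramp_le k x
  · have h0 := lineDeriv_ramp_nonneg k x
    have h1 := lineDeriv_ramp_le k x
    have hnn : 0 ≤ (A k).indicator (fun _ => C) x := Set.indicator_nonneg (fun _ _ => hC) x
    show -(_ * _) ≤ (A k).indicator (fun _ => C) x
    by_cases hxS : x ∈ S
    swap
    · rw [image_eq_zero_of_notMem_tsupport hxS]; simpa using hnn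
    rcases lt_or_ge (x (Fin.last n)) 0 with hx | hx
    · rw [lineDeriv_ramp_of_neg k hx]; simpa using hnn
    rcases lt_or_ge 1 ((k : ℝ) * x (Fin.last n)) with hx1 | hx1
    · rw [lineDeriv_ramp_of_one_lt k hx1]; simpa using hnn
    have hYx := hb x hx
    rcases hx.eq_or_lt with hx0 | hx0
    · rw [← hx0] at hYx
      have : 0 ≤ Y (Fin.last n) x := by simpa using hYx
      linarith [mul_nonneg h0 this]
    · rw [Set.indicator_of_mem (show x ∈ A k from ⟨hxS, hx0, hx1⟩)]
      nlinarith [mul_le_mul_of_nonneg_left hYx h0,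
        mul_le_mul_of_nonneg_right h1 (mul_nonneg hC hx)]

lemma lipschitzWith_mul_of_bounded {α : Type*} [PseudoMetricSpace α] {f g : α → ℝ} {K K' B B' : ℝ≥0}
    (hf : LipschitzWith K f) (hg : LipschitzWith K' g) (hfB : ∀ x, |f x| ≤ B)
    (hgB : ∀ x, |g x| ≤ B') : LipschitzWith (B * K' + B' * K) fun x => f x * g x := by
  refine LipschitzWith.of_dist_le_mul fun x y => ?_
  have h1 := hf.dist_le_mul x y
  have h2 := hg.dist_le_mul x y
  rw [Real.dist_eq] at h1 h2 ⊢
  have : f x * g x - f y * g y = f x * (g x - g y) + g y * (f x - f y) := by ring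
  rw [this]
  refine (abs_add_le _ _).trans ?_
  rw [abs_mul, abs_mul]
  push_cast
  have h3 : |f x| * |g x - g y| ≤ B * (K' * dist x y) :=
    mul_le_mul (hfB x) h2 (abs_nonneg _) B.coe_nonneg
  have h4 : |g y| * |f x - f y| ≤ B' * (K * dist x y) :=
    mul_le_mul (hgB y) h1 (abs_nonneg _) B'.coe_nonneg
  nlinarith

/-- A bounded Lipschitz function on a set has a bounded Lipschitz extension. -/
lemma exists_bounded_lipschitz_extension {α : Type*} [PseudoMetricSpace α] {f : α → ℝ} {S : Set α}
    {K B : ℝ≥0} (hf : LipschitzOnWith K f S) (hB : ∀ x ∈ S, |f x| ≤ B) :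
    ∃ g : α → ℝ, LipschitzWith K g ∧ Set.EqOn f g S ∧ ∀ x, |g x| ≤ B := by
  obtain ⟨g, hg, hfg⟩ := hf.extend_real
  refine ⟨fun x => max (min (g x) B) (-B), (hg.min_const _).max_const _, fun x hx => ?_,
    fun x => abs_le.2 ⟨le_max_right _ _, max_le (min_le_right _ _) ?_⟩⟩
  · have := abs_le.1 (hB x hx)
    rw [hfg hx] at this ⊢
    simp [this.1, this.2]
  · linarith [B.coe_nonneg]

lemma norm_eLast : ‖eLast n‖ = 1 := by simp [eLast]

lemma eLast_last : eLast n (Fin.last n) = 1 := by simp [eLast]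

/-- The positive part of a Lipschitz function on a half ball which is nonpositive on the spherical
part of the boundary extends by zero. -/
lemma exists_lipschitz_posPart {z₀ : Eucl n} (hz : z₀ (Fin.last n) = 0) {R : ℝ} (hR : 0 < R)
    {K : ℝ≥0} {f : Eucl n → ℝ}
    (hf : LipschitzOnWith K f (closedBall z₀ R ∩ {x | 0 ≤ x (Fin.last n)}))
    (hs : ∀ x : Eucl n, ‖x - z₀‖ = R → 0 ≤ x (Fin.last n) → f x ≤ 0) :
    ∃ W : Eucl n → ℝ, LipschitzWith K W ∧ (∀ x, 0 ≤ W x) ∧ (∀ x, R ≤ ‖x - z₀‖ → W x = 0) ∧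
      ∀ x, ‖x - z₀‖ ≤ R → 0 ≤ x (Fin.last n) → W x = max (f x) 0 := by
  obtain ⟨g, hg, hfg⟩ := hf.extend_real
  have hd : LipschitzWith K fun x : Eucl n => (K : ℝ) * (R - ‖x - z₀‖) := by
    refine LipschitzWith.of_le_add_mul _ fun x y => ?_
    rw [← mul_add]
    gcongr
    have := norm_sub_norm_le (y - z₀) (x - z₀)
    rw [sub_sub_sub_cancel_right] at this
    have h2 : dist x y = ‖y - x‖ := by rw [dist_comm, dist_eq_norm]
    linarith
  have hm : LipschitzWith K fun x : Eucl n => min (g x) (K * (R - ‖x - z₀‖)) := by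
    simpa using hg.min hd
  refine ⟨fun x => max (min (g x) (K * (R - ‖x - z₀‖))) 0, hm.max_const 0,
    fun x => le_max_right _ _, fun x hx => ?_, fun x hx hxl => ?_⟩
  · refine max_eq_right ((min_le_right _ _).trans ?_)
    exact mul_nonpos_of_nonneg_of_nonpos K.coe_nonneg (by linarith)
  · have hxS : x ∈ closedBall z₀ R ∩ {x : Eucl n | 0 ≤ x (Fin.last n)} :=
      ⟨mem_closedBall_iff_norm.2 hx, hxl⟩
    suffices h : ∃ y : Eucl n, ‖y - z₀‖ = R ∧ 0 ≤ y (Fin.last n) ∧ dist x y = R - ‖x - z₀‖ by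
      obtain ⟨y, hy, hyl, hxy⟩ := h
      have hyS : y ∈ closedBall z₀ R ∩ {x : Eucl n | 0 ≤ x (Fin.last n)} :=
        ⟨mem_closedBall_iff_norm.2 hy.le, hyl⟩
      have h1 := hf.dist_le_mul x hxS y hyS
      rw [hxy, Real.dist_eq] at h1
      have h2 := hs y hy hyl
      have h3 : f x ≤ K * (R - ‖x - z₀‖) := by linarith [le_abs_self (f x - f y)]
      rw [hfg hxS] at h3 ⊢
      simp only [min_eq_left h3]
    by_cases hxz : x = z₀
    · refine ⟨z₀ + R • eLast n, ?_, ?_, ?_⟩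
      · simp [norm_smul, norm_eLast, abs_of_pos hR]
      · simp [hz, eLast_last, hR.le]
      · simp [hxz, norm_smul, norm_eLast, abs_of_pos hR]
    · have hpos : 0 < ‖x - z₀‖ := norm_pos_iff.2 (sub_ne_zero.2 hxz)
      refine ⟨z₀ + (R / ‖x - z₀‖) • (x - z₀), ?_, ?_, ?_⟩
      · rw [add_sub_cancel_left, norm_smul, Real.norm_of_nonneg (by positivity)]
        field_simp
      · simp only [PiLp.add_apply, PiLp.smul_apply, PiLp.sub_apply, hz, smul_eq_mul]
        simp only [sub_zero, zero_add]
        positivity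
      · rw [dist_comm, dist_eq_norm, show z₀ + (R / ‖x - z₀‖) • (x - z₀) - x =
          (R / ‖x - z₀‖ - 1) • (x - z₀) by module, norm_smul, Real.norm_of_nonneg]
        · field_simp
        · rw [sub_nonneg, le_div_iff₀ hpos]; linarith

/-- The set `{(x, z, p) : |x - z₀| ≤ R, |z| ≤ M, |p| ≤ M}`. -/
def jetSet (z₀ : Eucl n) (R M : ℝ) : Set (Eucl n × ℝ × Eucl n) :=
  closedBall z₀ R ×ˢ closedBall (0 : ℝ) M ×ˢ closedBall (0 : Eucl n) M

lemma jetSet_subset {z₀ : Eucl n} {R M : ℝ} (hR : ‖z₀‖ + R < 1) :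
    jetSet z₀ R M ⊆ ball (0 : Eucl n) 1 ×ˢ (Set.univ : Set ℝ) ×ˢ (Set.univ : Set (Eucl n)) := by
  rintro ⟨x, z, p⟩ ⟨hx, -⟩
  refine ⟨?_, trivial, trivial⟩
  have := mem_closedBall_iff_norm.1 hx
  rw [mem_ball_zero_iff]
  have h2 := norm_add_le (x - z₀) z₀
  rw [sub_add_cancel] at h2
  simp only at this ⊢
  linarith

lemma isOpen_jetDomain :
    IsOpen (ball (0 : Eucl n) 1 ×ˢ (Set.univ : Set ℝ) ×ˢ (Set.univ : Set (Eucl n))) :=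
  isOpen_ball.prod (isOpen_univ.prod isOpen_univ)

lemma H0.differentiableAt {F : Eucl n → ℝ → Eucl n → Eucl n} {F₀ : Eucl n → ℝ → Eucl n → ℝ}
    (hF : H0 F F₀) {x : Eucl n} (hx : x ∈ ball (0 : Eucl n) 1) (z : ℝ) (p : Eucl n) :
    DifferentiableAt ℝ (fun q : Eucl n × ℝ × Eucl n => F q.1 q.2.1 q.2.2) (x, z, p) :=
  (hF.1.differentiableOn one_ne_zero).differentiableAt
    (isOpen_jetDomain.mem_nhds ⟨hx, trivial, trivial⟩)

lemma H0.exists_bound {F : Eucl n → ℝ → Eucl n → Eucl n} {F₀ : Eucl n → ℝ → Eucl n → ℝ}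
    (hF : H0 F F₀) {z₀ : Eucl n} {R : ℝ} (hR : ‖z₀‖ + R < 1) (M : ℝ) :
    ∃ C : ℝ≥0, 0 < C ∧ ∀ q ∈ jetSet z₀ R M,
      ‖fderiv ℝ (fun q : Eucl n × ℝ × Eucl n => F q.1 q.2.1 q.2.2) q‖ ≤ C ∧
      ‖F q.1 q.2.1 q.2.2‖ ≤ C ∧ |F₀ q.1 q.2.1 q.2.2| ≤ C := by
  have hK : IsCompact (jetSet z₀ R M) := (isCompact_closedBall _ _).prod
    ((isCompact_closedBall _ _).prod (isCompact_closedBall _ _))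
  have hsub := jetSet_subset (M := M) hR
  have h1 := (hF.1.continuousOn_fderiv_of_isOpen isOpen_jetDomain le_rfl).mono hsub
  obtain ⟨C1, hC1⟩ := hK.exists_bound_of_continuousOn h1
  obtain ⟨C2, hC2⟩ := hK.exists_bound_of_continuousOn (hF.1.continuousOn.mono hsub)
  obtain ⟨C3, hC3⟩ := hK.exists_bound_of_continuousOn (hF.2.continuousOn.mono hsub)
  refine ⟨⟨|C1| + |C2| + |C3| + 1, by positivity⟩, ?_, fun q hq => ?_⟩
  · have : (0 : ℝ) < |C1| + |C2| + |C3| + 1 := by positivity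
    exact this
  · have a1 := abs_nonneg C1
    have a2 := abs_nonneg C2
    have a3 := abs_nonneg C3
    refine ⟨(hC1 q hq).trans ?_, (hC2 q hq).trans ?_, (hC3 q hq).trans ?_⟩ <;>
    · change _ ≤ |C1| + |C2| + |C3| + 1
      linarith [le_abs_self C1, le_abs_self C2, le_abs_self C3]

lemma convex_jetSet (z₀ : Eucl n) (R M : ℝ) : Convex ℝ (jetSet z₀ R M) :=
  (convex_closedBall _ _).prod ((convex_closedBall _ _).prod (convex_closedBall _ _))

lemma lipschitzOnWith_jetSet {F : Eucl n → ℝ → Eucl n → Eucl n} {F₀ : Eucl n → ℝ → Eucl n → ℝ}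
    (hF : H0 F F₀) {z₀ : Eucl n} {R M : ℝ} (hR : ‖z₀‖ + R < 1) {C : ℝ≥0}
    (hC : ∀ q ∈ jetSet z₀ R M,
      ‖fderiv ℝ (fun q : Eucl n × ℝ × Eucl n => F q.1 q.2.1 q.2.2) q‖ ≤ C) :
    LipschitzOnWith C (fun q : Eucl n × ℝ × Eucl n => F q.1 q.2.1 q.2.2) (jetSet z₀ R M) :=
  Convex.lipschitzOnWith_of_nnnorm_fderiv_le
    (fun q hq => hF.differentiableAt (jetSet_subset hR hq).1 q.2.1 q.2.2)
    (fun q hq => hC q hq) (convex_jetSet _ _ _)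

lemma hasFDerivAt_gradVar {F : Eucl n → ℝ → Eucl n → Eucl n} {x : Eucl n} {z : ℝ} {p : Eucl n}
    (h : DifferentiableAt ℝ (fun q : Eucl n × ℝ × Eucl n => F q.1 q.2.1 q.2.2) (x, z, p)) :
    HasFDerivAt (F x z) ((fderiv ℝ (fun q : Eucl n × ℝ × Eucl n => F q.1 q.2.1 q.2.2) (x, z, p)).comp
      ((ContinuousLinearMap.inr ℝ (Eucl n) (ℝ × Eucl n)).comp
        (ContinuousLinearMap.inr ℝ ℝ (Eucl n)))) p := by
  have h2 : HasFDerivAt (fun p : Eucl n => (x, z, p))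
      ((ContinuousLinearMap.inr ℝ (Eucl n) (ℝ × Eucl n)).comp
        (ContinuousLinearMap.inr ℝ ℝ (Eucl n))) p :=
    HasFDerivAt.comp p (hasFDerivAt_prodMk_right x (z, p)) (hasFDerivAt_prodMk_right z p)
  exact HasFDerivAt.comp p h.hasFDerivAt h2

/-- Ellipticity makes `F(x, z, ·)` monotone. -/
lemma H1.monotone {F : Eucl n → ℝ → Eucl n → Eucl n} {F₀ : Eucl n → ℝ → Eucl n → ℝ}
    (hF : H0 F F₀) (hell : H1 F) {M : ℝ} (hM : 0 < M) {x : Eucl n}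
    (hx : x ∈ ball (0 : Eucl n) 1) {z : ℝ} (hz : |z| ≤ M) {p p' : Eucl n} (hp : ‖p‖ ≤ M)
    (hp' : ‖p'‖ ≤ M) : 0 ≤ ⟪F x z p - F x z p', p - p'⟫_ℝ := by
  obtain ⟨lam, hlam, hl⟩ := hell M hM
  set γ : ℝ → Eucl n := fun t => p' + t • (p - p') with hγ
  have hγd : ∀ t, HasDerivAt γ (p - p') t := fun t => by
    have := ((hasDerivAt_id t).smul_const (p - p')).const_add p'
    rw [one_smul] at this
    exact this
  have hd : ∀ t, HasDerivAt (fun t => ⟪F x z (γ t), p - p'⟫_ℝ)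
      ⟪fderiv ℝ (F x z) (γ t) (p - p'), p - p'⟫_ℝ t := fun t => by
    have h1 := (hasFDerivAt_gradVar (hF.differentiableAt hx z (γ t))).differentiableAt.hasFDerivAt
    have h2 := h1.comp_hasDerivAt t (hγd t)
    simpa using h2.inner ℝ (hasDerivAt_const t (p - p'))
  have hmono : MonotoneOn (fun t => ⟪F x z (γ t), p - p'⟫_ℝ) (Set.Icc (0 : ℝ) 1) := by
    refine monotoneOn_of_deriv_nonneg (convex_Icc 0 1)
      (fun t _ => (hd t).continuousAt.continuousWithinAt)
      (fun t _ => (hd t).differentiableAt.differentiableWithinAt) fun t ht => ?_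
    rw [(hd t).deriv]
    rw [interior_Icc] at ht
    have : ‖γ t‖ ≤ M := by
      have := (convex_closedBall (0 : Eucl n) M).add_smul_sub_mem
        (mem_closedBall_zero_iff.2 hp') (mem_closedBall_zero_iff.2 hp) ⟨ht.1.le, ht.2.le⟩
      exact mem_closedBall_zero_iff.1 this
    exact (by positivity : (0 : ℝ) ≤ lam * ‖p - p'‖ ^ 2).trans (hl x hx z hz _ this _)
  have := hmono (Set.left_mem_Icc.2 zero_le_one) (Set.right_mem_Icc.2 zero_le_one) zero_le_one
  simp only [hγ, zero_smul, add_zero, one_smul, add_sub_cancel] at this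
  rw [inner_sub_left]
  linarith

/-- `Θ` bounds from below `tr(A B)` for every `A` with ellipticity `lam` and norm at most `C`. -/
def PucciGE (lam C Θ : ℝ) (B : Eucl n →L[ℝ] Eucl n) : Prop :=
  ∀ A : Eucl n →L[ℝ] Eucl n, (∀ ξ, lam * ‖ξ‖ ^ 2 ≤ ⟪A ξ, ξ⟫_ℝ) → ‖A‖ ≤ C →
    Θ ≤ ∑ i, (A (B (EuclideanSpace.single i 1))) i

lemma abs_apply_le_norm (v : Eucl n) (i : Fin (n + 1)) : |v i| ≤ ‖v‖ := by
  simpa using PiLp.norm_apply_le (p := 2) v i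

/-- Lower bound for the divergence of `x ↦ F(x, φ(x), ∇φ(x))`. -/
lemma divergence_lower_bound {F : Eucl n → ℝ → Eucl n → Eucl n} {φ : Eucl n → ℝ}
    {P : Eucl n → Eucl n} {x : Eucl n} {C M Θ lam : ℝ} (hM : 0 < M) (hC : 0 ≤ C)
    (hd : DifferentiableAt ℝ (fun q : Eucl n × ℝ × Eucl n => F q.1 q.2.1 q.2.2) (x, φ x, P x))
    (hCb : ‖fderiv ℝ (fun q : Eucl n × ℝ × Eucl n => F q.1 q.2.1 q.2.2) (x, φ x, P x)‖ ≤ C)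
    (hφ : HasGradientAt φ (P x) x) (hP : DifferentiableAt ℝ P x) (hPM : ‖P x‖ ≤ M)
    (hell : ∀ ξ, lam * ‖ξ‖ ^ 2 ≤ ⟪fderiv ℝ (F x (φ x)) (P x) ξ, ξ⟫_ℝ)
    (hpucci : PucciGE lam C Θ (fderiv ℝ P x)) :
    DifferentiableAt ℝ (fun y => F y (φ y) (P y)) x ∧
      Θ - (n + 1) * (C * (1 + M)) ≤
        ∑ i, fderiv ℝ (fun y => F y (φ y) (P y)) x (EuclideanSpace.single i 1) i := by
  set T := fderiv ℝ (fun q : Eucl n × ℝ × Eucl n => F q.1 q.2.1 q.2.2) (x, φ x, P x) with hT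
  have hjet : HasFDerivAt (fun y => (y, φ y, P y))
      ((ContinuousLinearMap.id ℝ (Eucl n)).prod ((fderiv ℝ φ x).prod (fderiv ℝ P x))) x :=
    (hasFDerivAt_id x).prodMk (hφ.differentiableAt.hasFDerivAt.prodMk hP.hasFDerivAt)
  have hX : HasFDerivAt (fun y => F y (φ y) (P y)) (T.comp
      ((ContinuousLinearMap.id ℝ (Eucl n)).prod ((fderiv ℝ φ x).prod (fderiv ℝ P x)))) x :=
    HasFDerivAt.comp x (f := fun y => (y, φ y, P y)) hd.hasFDerivAt hjet
  refine ⟨hX.differentiableAt, ?_⟩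
  rw [hX.fderiv]
  have hA := (hasFDerivAt_gradVar hd).fderiv
  set A := fderiv ℝ (F x (φ x)) (P x) with hAdef
  have hAn : ‖A‖ ≤ C := by
    refine ContinuousLinearMap.opNorm_le_bound _ hC fun v => ?_
    have : ‖((0 : Eucl n), (0 : ℝ), v)‖ = ‖v‖ := by simp [Prod.norm_def]
    rw [hA]
    change ‖T (0, 0, v)‖ ≤ _
    refine (T.le_opNorm _).trans ?_
    rw [this]
    gcongr
  have key := hpucci A hell hAn
  have hi : ∀ i : Fin (n + 1), (A (fderiv ℝ P x (EuclideanSpace.single i 1))) i - C * (1 + M) ≤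
      (T.comp ((ContinuousLinearMap.id ℝ (Eucl n)).prod
        ((fderiv ℝ φ x).prod (fderiv ℝ P x)))) (EuclideanSpace.single i 1) i := by
    intro i
    set e : Eucl n := EuclideanSpace.single i 1 with he
    have hen : ‖e‖ = 1 := by simp [he]
    have hsplit : (T.comp ((ContinuousLinearMap.id ℝ (Eucl n)).prod
        ((fderiv ℝ φ x).prod (fderiv ℝ P x)))) e =
        T (e, fderiv ℝ φ x e, 0) + A (fderiv ℝ P x e) := by
      rw [hA]
      simp only [ContinuousLinearMap.comp_apply, ContinuousLinearMap.prod_apply,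
        ContinuousLinearMap.inr_apply, ContinuousLinearMap.id_apply]
      rw [← map_add]
      simp
    have hφe : |fderiv ℝ φ x e| ≤ M := by
      rw [hφ.fderiv_apply]
      refine (abs_real_inner_le_norm _ _).trans ?_
      rw [hen, mul_one]; exact hPM
    have hn : ‖(e, fderiv ℝ φ x e, (0 : Eucl n))‖ ≤ 1 + M := by
      simp only [Prod.norm_def, norm_zero, hen, Real.norm_eq_abs]
      refine max_le (by linarith) (max_le (by linarith) (by linarith))
    have hb : |T (e, fderiv ℝ φ x e, 0) i| ≤ C * (1 + M) :=
      (abs_apply_le_norm _ i).trans ((T.le_opNorm _).trans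
        (mul_le_mul hCb hn (norm_nonneg _) hC))
    rw [hsplit]
    simp only [PiLp.add_apply]
    linarith [(abs_le.1 hb).1]
  calc Θ - (n + 1) * (C * (1 + M))
      ≤ ∑ i, (A (fderiv ℝ P x (EuclideanSpace.single i 1))) i - (n + 1) * (C * (1 + M)) := by
        linarith
    _ = ∑ i, ((A (fderiv ℝ P x (EuclideanSpace.single i 1))) i - C * (1 + M)) := by
        simp [Finset.sum_sub_distrib]
    _ ≤ _ := Finset.sum_le_sum fun i _ => hi i

lemma fderiv_single_eq_gradient {f : Eucl n → ℝ} {x : Eucl n} (i : Fin (n + 1)) :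
    fderiv ℝ f x (EuclideanSpace.single i 1) = gradient f x i := by
  have h : fderiv ℝ f x (EuclideanSpace.single i 1) =
      ⟪gradient f x, EuclideanSpace.single i (1 : ℝ)⟫_ℝ := by
    rw [gradient, InnerProductSpace.toDual_symm_apply]
  rw [h, EuclideanSpace.inner_single_right]
  simp

lemma norm_gradient_eq (f : Eucl n → ℝ) (x : Eucl n) : ‖gradient f x‖ = ‖fderiv ℝ f x‖ :=
  (InnerProductSpace.toDual ℝ (Eucl n)).symm.norm_map _

lemma norm_gradient_le {f : Eucl n → ℝ} {K : ℝ≥0} (hf : LipschitzWith K f) (x : Eucl n) :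
    ‖gradient f x‖ ≤ K := by
  rw [norm_gradient_eq]
  exact norm_fderiv_le_of_lipschitz ℝ hf

lemma measurable_gradient (f : Eucl n → ℝ) : Measurable (gradient f) :=
  (InnerProductSpace.toDual ℝ (Eucl n)).symm.continuous.measurable.comp (measurable_fderiv ℝ f)

/-- A nonnegative function has zero gradient where it vanishes. -/
lemma gradient_eq_zero_of_nonneg {W : Eucl n → ℝ} (hW : ∀ x, 0 ≤ W x) {x : Eucl n} (hx : W x = 0) :
    gradient W x = 0 := by
  have : IsLocalMin W x := Filter.Eventually.of_forall fun y => by rw [hx]; exact hW y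
  rw [gradient, this.fderiv_eq_zero, map_zero]

lemma inner_eq_sum (v w : Eucl n) : ⟪v, w⟫_ℝ = ∑ i, v i * w i := by
  simp [PiLp.inner_apply, mul_comm]

/-- Product rule for the divergence of a vector field multiplied by a scalar function. -/
lemma sum_lineDeriv_mul {X : Fin (n + 1) → Eucl n → ℝ} {W : Eucl n → ℝ} {x : Eucl n}
    (hX : ∀ i, DifferentiableAt ℝ (X i) x) (hW : DifferentiableAt ℝ W x) :
    ∑ i, lineDeriv ℝ (fun y => X i y * W y) x (EuclideanSpace.single i 1) =
      (∑ i, X i x * gradient W x i) +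
        W x * ∑ i, fderiv ℝ (X i) x (EuclideanSpace.single i 1) := by
  rw [Finset.mul_sum, ← Finset.sum_add_distrib]
  refine Finset.sum_congr rfl fun i _ => ?_
  rw [((hX i).fun_mul hW).lineDeriv_eq_fderiv, fderiv_fun_mul (hX i) hW]
  simp [fderiv_single_eq_gradient]

/-- Measurability of the integrand of the variational inequality. -/
lemma aestronglyMeasurable_integrand {F : Eucl n → ℝ → Eucl n → Eucl n}
    {F₀ : Eucl n → ℝ → Eucl n → ℝ} (hF : H0 F F₀) {U W : Eucl n → ℝ} (hU : Measurable U)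
    (hW : Measurable W) :
    AEStronglyMeasurable (fun x => ⟪F x (U x) (gradient U x), gradient W x⟫_ℝ +
      F₀ x (U x) (gradient U x) * W x) (volume.restrict (hBall (0 : Eucl n) 1)) := by
  set D : Set (Eucl n × ℝ × Eucl n) :=
    ball (0 : Eucl n) 1 ×ˢ (Set.univ : Set ℝ) ×ˢ (Set.univ : Set (Eucl n)) with hD
  have hDm : MeasurableSet D := isOpen_jetDomain.measurableSet
  have hj : Measurable fun x => (x, U x, gradient U x) :=
    measurable_id.prodMk (hU.prodMk (measurable_gradient U))
  classical
  have h1 : Measurable (D.piecewise (fun q : Eucl n × ℝ × Eucl n => F q.1 q.2.1 q.2.2) 0) :=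
    hF.1.continuousOn.measurable_piecewise continuousOn_const hDm
  have h2 : Measurable (D.piecewise (fun q : Eucl n × ℝ × Eucl n => F₀ q.1 q.2.1 q.2.2) 0) :=
    hF.2.continuousOn.measurable_piecewise continuousOn_const hDm
  have h3 := ((h1.comp hj).inner (𝕜 := ℝ) (measurable_gradient W)).add ((h2.comp hj).mul hW)
  refine h3.aestronglyMeasurable.congr ?_
  have hm : MeasurableSet (hBall (0 : Eucl n) 1) := measurableSet_ball.inter measurableSet_upper
  filter_upwards [ae_restrict_mem hm] with x hx
  have hxD : (x, U x, gradient U x) ∈ D := ⟨hx.1, trivial, trivial⟩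
  simp only [Pi.add_apply, Pi.mul_apply, Function.comp_apply, Set.piecewise_eq_of_mem _ _ _ hxD]

lemma ball_subset_unit {z₀ : Eucl n} {R : ℝ} (hR : ‖z₀‖ + R < 1) :
    closedBall z₀ R ⊆ ball (0 : Eucl n) 1 := by
  intro x hx
  have := mem_closedBall_iff_norm.1 hx
  rw [mem_ball_zero_iff]
  have h2 := norm_add_le (x - z₀) z₀
  rw [sub_add_cancel] at h2
  linarith

/-- A Lipschitz function vanishing outside a ball is bounded. -/
lemma abs_le_of_vanish {W : Eucl n → ℝ} {K : ℝ≥0} (hW : LipschitzWith K W) {z₀ : Eucl n} {R : ℝ}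
    (hR : 0 < R) (h0 : ∀ x, R ≤ ‖x - z₀‖ → W x = 0) (x : Eucl n) : |W x| ≤ K * (2 * R) := by
  by_cases hx : R ≤ ‖x - z₀‖
  · rw [h0 x hx, abs_zero]; positivity
  · push Not at hx
    have h1 : W (z₀ + R • eLast n) = 0 := h0 _ (by simp [norm_smul, norm_eLast, abs_of_pos hR])
    have h2 := hW.dist_le_mul x (z₀ + R • eLast n)
    rw [h1, Real.dist_eq, sub_zero] at h2
    refine h2.trans ?_
    gcongr
    rw [dist_eq_norm, ← sub_sub]
    refine (norm_sub_le _ _).trans ?_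
    rw [norm_smul, norm_eLast, Real.norm_of_nonneg hR.le]
    linarith

/-- Pointwise comparison of the integrand of the variational inequality, tested with the positive
part `W` of `φ - U`, with the divergence of `W F(x, φ, ∇φ)`. -/
lemma integrand_le {F : Eucl n → ℝ → Eucl n → Eucl n} {F₀ : Eucl n → ℝ → Eucl n → ℝ}
    (hF : H0 F F₀) (hell : H1 F) {z₀ : Eucl n} {R M : ℝ} (hR : ‖z₀‖ + R < 1) (hM : 0 < M)
    {C : ℝ≥0} (hC : ∀ q ∈ jetSet z₀ R M,
      ‖fderiv ℝ (fun q : Eucl n × ℝ × Eucl n => F q.1 q.2.1 q.2.2) q‖ ≤ C ∧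
      ‖F q.1 q.2.1 q.2.2‖ ≤ C ∧ |F₀ q.1 q.2.1 q.2.2| ≤ C)
    {lam : ℝ} (hlam : ∀ x ∈ ball (0 : Eucl n) 1, ∀ z : ℝ, |z| ≤ M → ∀ p : Eucl n, ‖p‖ ≤ M →
      ∀ ξ : Eucl n, lam * ‖ξ‖ ^ 2 ≤ ⟪fderiv ℝ (F x z) p ξ, ξ⟫_ℝ)
    {U φ W : Eucl n → ℝ} {P : Eucl n → Eucl n} {x : Eucl n} (hx : x ∈ closedBall z₀ R)
    (hU : DifferentiableAt ℝ U x) (hUM : |U x| ≤ M) (hUg : ‖gradient U x‖ ≤ M)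
    (hφ : HasGradientAt φ (P x) x) (hP : DifferentiableAt ℝ P x) (hφM : |φ x| ≤ M)
    (hPM : ‖P x‖ ≤ M) (hlt : U x < φ x) (hW : W =ᶠ[𝓝 x] fun y => φ y - U y)
    (hpucci : PucciGE lam C ((n + 1) * (C * (1 + M)) + 2 * M * C + C + 1) (fderiv ℝ P x)) :
    DifferentiableAt ℝ (fun y => F y (φ y) (P y)) x ∧
    ⟪F x (U x) (gradient U x), gradient W x⟫_ℝ + F₀ x (U x) (gradient U x) * W x ≤
      (∑ i, F x (φ x) (P x) i * gradient W x i) +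
        W x * (∑ i, fderiv ℝ (fun y => F y (φ y) (P y)) x (EuclideanSpace.single i 1) i) - W x := by
  have hx1 := ball_subset_unit hR hx
  have hWx : W x = φ x - U x := hW.eq_of_nhds
  have hWg : gradient W x = P x - gradient U x := by
    have h1 : HasGradientAt (fun y => φ y - U y) (P x - gradient U x) x := by
      rw [hasGradientAt_iff_hasFDerivAt, map_sub]
      exact hφ.hasFDerivAt.sub hU.hasGradientAt.hasFDerivAt
    exact (h1.congr_of_eventuallyEq hW).gradient
  have hmem : ∀ {z p}, |z| ≤ M → ‖p‖ ≤ M → ((x, z, p) : Eucl n × ℝ × Eucl n) ∈ jetSet z₀ R M :=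
    fun hz hp => ⟨hx, mem_closedBall_zero_iff.2 hz, mem_closedBall_zero_iff.2 hp⟩
  obtain ⟨hXd, hdiv⟩ := divergence_lower_bound hM C.coe_nonneg
    (hF.differentiableAt hx1 (φ x) (P x)) (hC _ (hmem hφM hPM)).1 hφ hP hPM
    (hlam x hx1 _ hφM _ hPM) hpucci
  refine ⟨hXd, ?_⟩
  have hWpos : 0 < W x := by rw [hWx]; linarith
  have hmono := H1.monotone hF hell hM hx1 hφM hPM hUg
  have hlip := (lipschitzOnWith_jetSet hF hR fun q hq => (hC q hq).1).dist_le_mul _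
    (hmem hφM hUg) _ (hmem hUM hUg)
  have hdist : dist ((x, φ x, gradient U x) : Eucl n × ℝ × Eucl n) (x, U x, gradient U x) = W x := by
    simp only [Prod.dist_eq, dist_self, Real.dist_eq, ← hWx, abs_of_pos hWpos]
    simp [hWpos.le]
  rw [hdist, dist_eq_norm] at hlip
  have hgn : ‖gradient W x‖ ≤ 2 * M := by
    rw [hWg]; exact (norm_sub_le _ _).trans (by linarith)
  have hin : |⟪F x (φ x) (gradient U x) - F x (U x) (gradient U x), gradient W x⟫_ℝ| ≤
      C * W x * (2 * M) :=
    (abs_real_inner_le_norm _ _).trans (mul_le_mul hlip hgn (norm_nonneg _) (by positivity))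
  have hF0 : |F₀ x (U x) (gradient U x) * W x| ≤ C * W x := by
    rw [abs_mul, abs_of_pos hWpos]
    exact mul_le_mul_of_nonneg_right (hC _ (hmem hUM hUg)).2.2 hWpos.le
  rw [← inner_eq_sum]
  rw [← hWg, inner_sub_left] at hmono
  rw [inner_sub_left] at hin
  have h5 := mul_le_mul_of_nonneg_left hdiv hWpos.le
  have h1 := (abs_le.1 hin).1
  have h2 := (abs_le.1 hF0).2
  nlinarith

lemma isCompact_hasCompactSupport_of_vanish {W : Eucl n → ℝ} {z₀ : Eucl n} {R : ℝ}
    (h0 : ∀ x, R ≤ ‖x - z₀‖ → W x = 0) : HasCompactSupport W := by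
  refine HasCompactSupport.intro (isCompact_closedBall z₀ R) fun x hx => h0 x ?_
  rw [mem_closedBall_iff_norm, not_le] at hx
  exact hx.le

/-- A `C¹` function is Lipschitz on closed balls. -/
lemma exists_lipschitzOnWith_closedBall {P : Eucl n → Eucl n} (hP : ContDiff ℝ 1 P) (z₀ : Eucl n)
    (R : ℝ) : ∃ K : ℝ≥0, LipschitzOnWith K P (closedBall z₀ R) := by
  obtain ⟨K, hK⟩ := (isCompact_closedBall z₀ R).exists_bound_of_continuousOn
    (hP.continuous_fderiv one_ne_zero).continuousOn
  refine ⟨K.toNNReal, (convex_closedBall _ _).lipschitzOnWith_of_nnnorm_fderiv_le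
    (fun x _ => (hP.differentiable one_ne_zero) x) fun x hx => ?_⟩
  rw [← NNReal.coe_le_coe, coe_nnnorm]
  exact (hK x hx).trans (Real.le_coe_toNNReal K)

lemma fderiv_coord {X : Eucl n → Eucl n} {x : Eucl n} (hX : DifferentiableAt ℝ X x)
    (i : Fin (n + 1)) (v : Eucl n) : fderiv ℝ (fun y => X y i) x v = fderiv ℝ X x v i := by
  have h1 : HasFDerivAt (fun y => X y i)
      ((EuclideanSpace.proj i : Eucl n →L[ℝ] ℝ).comp (fderiv ℝ X x)) x :=
    (EuclideanSpace.proj i : Eucl n →L[ℝ] ℝ).hasFDerivAt.comp x hX.hasFDerivAt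
  rw [h1.fderiv]
  rfl

lemma lipschitzOnWith_field {F : Eucl n → ℝ → Eucl n → Eucl n} {F₀ : Eucl n → ℝ → Eucl n → ℝ}
    (hF : H0 F F₀) {z₀ : Eucl n} {R M : ℝ} (hR : ‖z₀‖ + R < 1) {C : ℝ≥0}
    (hC : ∀ q ∈ jetSet z₀ R M,
      ‖fderiv ℝ (fun q : Eucl n × ℝ × Eucl n => F q.1 q.2.1 q.2.2) q‖ ≤ C)
    {φ : Eucl n → ℝ} {P : Eucl n → Eucl n} {K K' : ℝ≥0}
    (hφ : LipschitzOnWith K φ (closedBall z₀ R)) (hP : LipschitzOnWith K' P (closedBall z₀ R))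
    (hφM : ∀ x ∈ closedBall z₀ R, |φ x| ≤ M) (hPM : ∀ x ∈ closedBall z₀ R, ‖P x‖ ≤ M) :
    LipschitzOnWith (C * max 1 (max K K')) (fun x => F x (φ x) (P x)) (closedBall z₀ R) := by
  have h1 : LipschitzOnWith (max 1 (max K K'))
      (fun x => ((x, φ x, P x) : Eucl n × ℝ × Eucl n)) (closedBall z₀ R) :=
    LipschitzWith.id.lipschitzOnWith.prodMk (hφ.prodMk hP)
  have hjet : ∀ x ∈ closedBall z₀ R, ((x, φ x, P x) : Eucl n × ℝ × Eucl n) ∈ jetSet z₀ R M :=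
    fun x hx => ⟨hx, mem_closedBall_zero_iff.2 (hφM x hx), mem_closedBall_zero_iff.2 (hPM x hx)⟩
  have h2 := lipschitzOnWith_jetSet hF hR hC
  refine LipschitzOnWith.of_dist_le_mul fun x hx y hy => ?_
  have h3 := h1.dist_le_mul x hx y hy
  have h4 := h2.dist_le_mul _ (hjet x hx) _ (hjet y hy)
  refine h4.trans ?_
  rw [NNReal.coe_mul, mul_assoc]
  exact mul_le_mul_of_nonneg_left h3 C.coe_nonneg

set_option maxHeartbeats 1000000 in
/-- The test function `W` has vanishing integral as soon as it satisfies the variational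
inequality for a strict subsolution. -/
lemma core_comparison {F : Eucl n → ℝ → Eucl n → Eucl n} {F₀ : Eucl n → ℝ → Eucl n → ℝ}
    (hF : H0 F F₀) (hell : H1 F) {z₀ : Eucl n} (hz : z₀ (Fin.last n) = 0) {R M : ℝ}
    (hR0 : 0 < R) (hR : ‖z₀‖ + R < 1) (hM : 0 < M)
    {C : ℝ≥0} (hC : ∀ q ∈ jetSet z₀ R M,
      ‖fderiv ℝ (fun q : Eucl n × ℝ × Eucl n => F q.1 q.2.1 q.2.2) q‖ ≤ C ∧
      ‖F q.1 q.2.1 q.2.2‖ ≤ C ∧ |F₀ q.1 q.2.1 q.2.2| ≤ C)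
    {lam : ℝ} (hlam : ∀ x ∈ ball (0 : Eucl n) 1, ∀ z : ℝ, |z| ≤ M → ∀ p : Eucl n, ‖p‖ ≤ M →
      ∀ ξ : Eucl n, lam * ‖ξ‖ ^ 2 ≤ ⟪fderiv ℝ (F x z) p ξ, ξ⟫_ℝ)
    {U φ : Eucl n → ℝ} {P : Eucl n → Eucl n} {L : ℝ≥0} (hLM : L ≤ M) (hU : LipschitzWith L U)
    (hUM : ∀ x ∈ closedBall z₀ R, |U x| ≤ M) (hφ : ∀ x, HasGradientAt φ (P x) x)
    (hP : ContDiff ℝ 1 P) (hφM : ∀ x ∈ closedBall z₀ R, |φ x| ≤ M)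
    (hPM : ∀ x ∈ closedBall z₀ R, ‖P x‖ ≤ M)
    (hsph : ∀ x : Eucl n, ‖x - z₀‖ = R → 0 ≤ x (Fin.last n) → φ x ≤ U x)
    (hpucci : ∀ x ∈ closedBall z₀ R, 0 < x (Fin.last n) → U x < φ x →
      PucciGE lam C ((n + 1) * (C * (1 + M)) + 2 * M * C + C + 1) (fderiv ℝ P x))
    (hbd : ∃ C' : ℝ, 0 ≤ C' ∧ ∀ x ∈ closedBall z₀ R, 0 ≤ x (Fin.last n) → U x < φ x →
      -C' * x (Fin.last n) ≤ F x (φ x) (P x) (Fin.last n) * (φ x - U x))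
    (hvar : ∀ (W : Eucl n → ℝ) (K : ℝ≥0), LipschitzWith K W → (∀ x, 0 ≤ W x) →
      (∀ x, R ≤ ‖x - z₀‖ → W x = 0) →
      (∀ x, ‖x - z₀‖ ≤ R → 0 ≤ x (Fin.last n) → W x = max (φ x - U x) 0) →
      0 ≤ ∫ x in hBall (0 : Eucl n) 1,
        (⟪F x (U x) (gradient U x), gradient W x⟫_ℝ + F₀ x (U x) (gradient U x) * W x)) :
    ∀ x ∈ closedBall z₀ R, 0 ≤ x (Fin.last n) → φ x ≤ U x := by
  have hMn : ∃ M' : ℝ≥0, (M' : ℝ) = M := ⟨⟨M, hM.le⟩, rfl⟩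
  obtain ⟨M', hM'⟩ := hMn
  -- the positive part
  have hφL : LipschitzOnWith M' φ (closedBall z₀ R) := by
    refine (convex_closedBall _ _).lipschitzOnWith_of_nnnorm_fderiv_le
      (fun x _ => (hφ x).differentiableAt) fun x hx => ?_
    rw [← NNReal.coe_le_coe, coe_nnnorm, hM', ← norm_gradient_eq, (hφ x).gradient]
    exact hPM x hx
  have hfL : LipschitzOnWith (M' + L) (fun x => φ x - U x)
      (closedBall z₀ R ∩ {x | 0 ≤ x (Fin.last n)}) :=
    (hφL.sub hU.lipschitzOnWith).mono Set.inter_subset_left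
  obtain ⟨W, hWL, hW0, hWv, hWeq⟩ := exists_lipschitz_posPart hz hR0 hfL
    fun x hx hxl => sub_nonpos.2 (hsph x hx hxl)
  have hint := hvar W _ hWL hW0 hWv hWeq
  set K := M' + L with hK
  have hWb : ∀ x, |W x| ≤ (K * (2 * R.toNNReal) : ℝ≥0) := fun x => by
    push_cast
    rw [Real.coe_toNNReal _ hR0.le]
    exact abs_le_of_vanish hWL hR0 hWv x
  -- points where `W` is positive
  have hpos : ∀ x, 0 ≤ x (Fin.last n) → W x ≠ 0 → ‖x - z₀‖ < R ∧ U x < φ x := fun x hxl hx => by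
    have h1 : ‖x - z₀‖ < R := by by_contra h; exact hx (hWv x (not_lt.1 h))
    refine ⟨h1, ?_⟩
    by_contra h
    rw [hWeq x h1.le hxl, max_eq_right (by linarith)] at hx
    exact hx rfl
  -- the vector field
  obtain ⟨KP, hKP⟩ := exists_lipschitzOnWith_closedBall hP z₀ R
  have hjet : ∀ x ∈ closedBall z₀ R, ((x, φ x, P x) : Eucl n × ℝ × Eucl n) ∈ jetSet z₀ R M :=
    fun x hx => ⟨hx, mem_closedBall_zero_iff.2 (hφM x hx), mem_closedBall_zero_iff.2 (hPM x hx)⟩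
  have hXL : LipschitzOnWith (C * max 1 (max M' KP)) (fun x => F x (φ x) (P x))
      (closedBall z₀ R) :=
    lipschitzOnWith_field hF hR (fun q hq => (hC q hq).1) hφL hKP hφM hPM
  have hXi : ∀ i, LipschitzOnWith (C * max 1 (max M' KP)) (fun x => F x (φ x) (P x) i)
      (closedBall z₀ R) := fun i => LipschitzOnWith.of_dist_le_mul fun x hx y hy => by
    refine le_trans ?_ (hXL.dist_le_mul x hx y hy)
    rw [Real.dist_eq, dist_eq_norm]
    exact abs_apply_le_norm (F x (φ x) (P x) - F y (φ y) (P y)) i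
  have hXb : ∀ i, ∀ x ∈ closedBall z₀ R, |F x (φ x) (P x) i| ≤ C := fun i x hx =>
    (abs_apply_le_norm _ _).trans (hC _ (hjet x hx)).2.1
  choose X hXlip hXeq hXbd using fun i => exists_bounded_lipschitz_extension (hXi i) (hXb i)
  obtain ⟨C', hC'0, hC'⟩ := hbd
  have hYl : ∀ i, LipschitzWith (C * K + (K * (2 * R.toNNReal)) * (C * max 1 (max M' KP)))
      fun x => X i x * W x := fun i =>
    lipschitzWith_mul_of_bounded (hXlip i) hWL (hXbd i) hWb
  have hYc : ∀ i, HasCompactSupport fun x => X i x * W x := fun i =>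
    isCompact_hasCompactSupport_of_vanish (R := R) (z₀ := z₀) fun x hx => by rw [hWv x hx, mul_zero]
  have hdiv := integral_divergence_nonpos hYl hYc
    hC'0 fun x hx => by
      by_cases hWx : W x = 0
      · rw [hWx, mul_zero]
        have : 0 ≤ C' * x (Fin.last n) := by positivity
        linarith
      · obtain ⟨h1, h2⟩ := hpos x hx hWx
        have hxR : x ∈ closedBall z₀ R := mem_closedBall_iff_norm.2 h1.le
        rw [← hXeq (Fin.last n) hxR, hWeq x h1.le hx, max_eq_left (by linarith)]
        exact hC' x hxR hx h2
  have hm : MeasurableSet (hBall (0 : Eucl n) 1) := measurableSet_ball.inter measurableSet_upper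
  -- pointwise inequality
  have hptw : ∀ᵐ x ∂(volume.restrict (hBall (0 : Eucl n) 1)),
      ⟪F x (U x) (gradient U x), gradient W x⟫_ℝ + F₀ x (U x) (gradient U x) * W x ≤
        ∑ i, lineDeriv ℝ (fun y => X i y * W y) x (EuclideanSpace.single i 1) - W x := by
    have hXd : ∀ᵐ x, ∀ i, DifferentiableAt ℝ (X i) x :=
      ae_all_iff.2 fun i => (hXlip i).ae_differentiableAt
    filter_upwards [ae_restrict_mem hm, ae_restrict_of_ae hXd,
      ae_restrict_of_ae hU.ae_differentiableAt, ae_restrict_of_ae hWL.ae_differentiableAt]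
      with x hx hXx hUx hWx
    have hxl : 0 < x (Fin.last n) := hx.2
    rw [sum_lineDeriv_mul hXx hWx]
    by_cases hW0x : W x = 0
    · simp [gradient_eq_zero_of_nonneg hW0 hW0x, hW0x]
    · obtain ⟨h1, h2⟩ := hpos x hxl.le hW0x
      have hxR : x ∈ closedBall z₀ R := mem_closedBall_iff_norm.2 h1.le
      have hn1 : ∀ᶠ y in 𝓝 x, y ∈ ball z₀ R := isOpen_ball.mem_nhds (mem_ball_iff_norm.2 h1)
      have hn2 : ∀ᶠ y in 𝓝 x, 0 < y (Fin.last n) :=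
        (isOpen_lt continuous_const continuous_last).mem_nhds hxl
      have hφc : Continuous φ := continuous_iff_continuousAt.2 fun y => (hφ y).continuousAt
      have hn3 : ∀ᶠ y in 𝓝 x, U y < φ y := (isOpen_lt hU.continuous hφc).mem_nhds h2
      have hWe : W =ᶠ[𝓝 x] fun y => φ y - U y := by
        filter_upwards [hn1, hn2, hn3] with y hy1 hy2 hy3
        rw [hWeq y (mem_ball_iff_norm.1 hy1).le hy2.le, max_eq_left (by linarith)]
      obtain ⟨hXd, hle⟩ := integrand_le hF hell hR hM hC hlam hxR hUx (hUM x hxR)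
        ((norm_gradient_le hU x).trans hLM) (hφ x) ((hP.differentiable one_ne_zero) x)
        (hφM x hxR) (hPM x hxR) h2 hWe (hpucci x hxR hxl h2)
      have hXe : ∀ i, X i =ᶠ[𝓝 x] fun y => F y (φ y) (P y) i := fun i => by
        filter_upwards [hn1] with y hy
        exact (hXeq i (ball_subset_closedBall hy)).symm
      have hfd : ∀ i, fderiv ℝ (X i) x (EuclideanSpace.single i 1) =
          fderiv ℝ (fun y => F y (φ y) (P y)) x (EuclideanSpace.single i 1) i := fun i => by
        rw [(hXe i).fderiv_eq, fderiv_coord hXd]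
      simp only [hfd, (hXe _).eq_of_nhds]
      exact hle
  -- integrability
  have hAint : IntegrableOn (fun x => ⟪F x (U x) (gradient U x), gradient W x⟫_ℝ +
      F₀ x (U x) (gradient U x) * W x) (hBall (0 : Eucl n) 1) := by
    have : IsFiniteMeasure (volume.restrict (hBall (0 : Eucl n) 1)) :=
      isFiniteMeasure_restrict.2
        ((measure_mono Set.inter_subset_left).trans_lt measure_ball_lt_top).ne
    refine Integrable.of_bound
      (aestronglyMeasurable_integrand hF hU.continuous.measurable hWL.continuous.measurable)
      (C * K + C * (K * (2 * R.toNNReal) : ℝ≥0)) ?_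
    filter_upwards [ae_restrict_mem hm] with x hx
    have hxl : 0 < x (Fin.last n) := hx.2
    by_cases hW0x : W x = 0
    · simp only [gradient_eq_zero_of_nonneg hW0 hW0x, hW0x, inner_zero_right, mul_zero, add_zero,
        norm_zero]
      positivity
    · obtain ⟨h1, h2⟩ := hpos x hxl.le hW0x
      have hxR : x ∈ closedBall z₀ R := mem_closedBall_iff_norm.2 h1.le
      have hj : ((x, U x, gradient U x) : Eucl n × ℝ × Eucl n) ∈ jetSet z₀ R M :=
        ⟨hxR, mem_closedBall_zero_iff.2 (hUM x hxR),
          mem_closedBall_zero_iff.2 ((norm_gradient_le hU x).trans hLM)⟩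
      refine (norm_add_le _ _).trans (add_le_add ?_ ?_)
      · exact (abs_real_inner_le_norm _ _).trans
          (mul_le_mul (hC _ hj).2.1 (norm_gradient_le hWL x) (norm_nonneg _) C.coe_nonneg)
      · rw [norm_mul]
        exact mul_le_mul (hC _ hj).2.2 (hWb x) (abs_nonneg _) C.coe_nonneg
  have hWint : IntegrableOn W (hBall (0 : Eucl n) 1) :=
    (hWL.continuous.integrable_of_hasCompactSupport
      (isCompact_hasCompactSupport_of_vanish hWv)).integrableOn
  have hDint : Integrable fun x =>
      ∑ i, lineDeriv ℝ (fun y => X i y * W y) x (EuclideanSpace.single i 1) :=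
    integrable_finsetSum _ fun i _ => integrable_lineDeriv_of_hasCompactSupport (hYl i) (hYc i) _
  have hsub : ∫ x in hBall (0 : Eucl n) 1,
      ∑ i, lineDeriv ℝ (fun y => X i y * W y) x (EuclideanSpace.single i 1) =
      ∫ x in {x : Eucl n | 0 < x (Fin.last n)},
      ∑ i, lineDeriv ℝ (fun y => X i y * W y) x (EuclideanSpace.single i 1) := by
    refine (setIntegral_eq_of_subset_of_forall_sdiff_eq_zero measurableSet_upper
      Set.inter_subset_right fun x hx => ?_).symm
    have hx2 : x ∉ closedBall z₀ R := fun h => hx.2 ⟨ball_subset_unit hR h, hx.1⟩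
    refine Finset.sum_eq_zero fun i _ => ?_
    have : (fun y => X i y * W y) =ᶠ[𝓝 x] fun _ => 0 := by
      filter_upwards [isClosed_closedBall.isOpen_compl.mem_nhds hx2] with y hy
      rw [Set.mem_compl_iff, mem_closedBall_iff_norm, not_le] at hy
      rw [hWv y hy.le, mul_zero]
    rw [this.lineDeriv_eq]
    exact deriv_const _ _
  have hWle : ∫ x in hBall (0 : Eucl n) 1, W x ≤ 0 := by
    have h1 := integral_mono_ae hAint (hDint.integrableOn.sub hWint) hptw
    have h2 := integral_sub hDint.integrableOn hWint (μ := volume.restrict (hBall (0 : Eucl n) 1))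
    simp only [Pi.sub_apply] at h1
    linarith
  have hWz : ∀ x ∈ hBall (0 : Eucl n) 1, W x = 0 := by
    have h0 : ∫ x in hBall (0 : Eucl n) 1, W x = 0 :=
      le_antisymm hWle (integral_nonneg hW0)
    have hae := (integral_eq_zero_iff_of_nonneg hW0 hWint).1 h0
    have hopen : IsOpen (hBall (0 : Eucl n) 1) :=
      isOpen_ball.inter (isOpen_lt continuous_const continuous_last)
    exact Measure.eqOn_open_of_ae_eq hae hopen hWL.continuous.continuousOn continuousOn_const
  intro x hx hxl
  have hWx : W x = 0 := by
    have hc : Filter.Tendsto (fun t : ℝ => W (x + t • eLast n)) (𝓝[>] 0) (𝓝 (W x)) := by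
      have : Continuous fun t : ℝ => W (x + t • eLast n) := hWL.continuous.comp (by fun_prop)
      simpa using (this.tendsto 0).mono_left nhdsWithin_le_nhds
    refine tendsto_nhds_unique hc (tendsto_const_nhds.congr' ?_)
    have hx1 := ball_subset_unit hR hx
    have hcb : Filter.Tendsto (fun t : ℝ => x + t • eLast n) (𝓝[>] 0) (𝓝 x) := by
      have : Continuous fun t : ℝ => x + t • eLast n := by fun_prop
      simpa using (this.tendsto 0).mono_left nhdsWithin_le_nhds
    filter_upwards [hcb.eventually (isOpen_ball.mem_nhds hx1), self_mem_nhdsWithin] with t ht ht0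
    refine (hWz _ ⟨ht, ?_⟩).symm
    have : 0 < t := ht0
    simp only [Set.mem_ofPred_eq, PiLp.add_apply, PiLp.smul_apply, eLast_last, smul_eq_mul, mul_one]
    linarith
  rw [hWeq x (mem_closedBall_iff_norm.1 hx) hxl] at hWx
  linarith [le_max_left (φ x - U x) 0]

/-- Testing the variational inequality with `u + ε W`. -/
lemma BdrySolution.variational {F : Eucl n → ℝ → Eucl n → Eucl n} {F₀ : Eucl n → ℝ → Eucl n → ℝ}
    {g u : Eucl n → ℝ} (hu : BdrySolution F F₀ g u) {U : Eucl n → ℝ}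
    (hUu : Set.EqOn u U (closedBall (0 : Eucl n) 1 ∩ {x | 0 ≤ x (Fin.last n)})) {K L : ℝ≥0}
    (hU : LipschitzWith L U) {W : Eucl n → ℝ} (hW : LipschitzWith K W) {z₀ : Eucl n} {R : ℝ}
    (hR : ‖z₀‖ + R < 1) (hWv : ∀ x, R ≤ ‖x - z₀‖ → W x = 0) (ε : ℝ)
    (hthin : ∀ x ∈ tBall (0 : Eucl n) 1, 0 ≤ u x + ε * W x) :
    0 ≤ ∫ x in hBall (0 : Eucl n) 1, (⟪F x (U x) (gradient U x), ε • gradient W x⟫_ℝ +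
      F₀ x (U x) (gradient U x) * (ε * W x)) := by
  have hadm : AdmissibleBdry g fun x => u x + ε * W x := by
    refine ⟨?_, fun x hx hxl => ?_, hthin⟩
    · obtain ⟨C, hC⟩ := hu.1.1
      have h1 : LipschitzWith (‖ε‖₊ * K) fun x => ε * W x := (lipschitzWith_smul ε).comp hW
      exact ⟨_, hC.add h1.lipschitzOnWith⟩
    · have : R ≤ ‖x - z₀‖ := by
        have := norm_sub_norm_le x z₀
        linarith
      simp only [hWv x this, mul_zero, add_zero]
      exact hu.1.2.1 x hx hxl
  have h := hu.2 _ hadm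
  refine h.trans (le_of_eq ?_)
  have hopen : IsOpen (hBall (0 : Eucl n) 1) :=
    isOpen_ball.inter (isOpen_lt continuous_const continuous_last)
  refine integral_congr_ae ?_
  filter_upwards [ae_restrict_mem hopen.measurableSet, ae_restrict_of_ae hU.ae_differentiableAt,
    ae_restrict_of_ae hW.ae_differentiableAt] with x hx hUx hWx
  have hEq : u =ᶠ[𝓝 x] U := by
    filter_upwards [hopen.mem_nhds hx] with y hy
    have hyl : 0 < y (Fin.last n) := hy.2
    exact hUu ⟨ball_subset_closedBall hy.1, hyl.le⟩
  have hgu : HasGradientAt u (gradient U x) x := hUx.hasGradientAt.congr_of_eventuallyEq hEq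
  have hgv : HasGradientAt (fun x => u x + ε * W x) (gradient U x + ε • gradient W x) x := by
    rw [hasGradientAt_iff_hasFDerivAt, map_add, map_smul]
    exact hgu.hasFDerivAt.add (hWx.hasGradientAt.hasFDerivAt.const_mul ε)
  rw [hgu.gradient, hgv.gradient, hEq.eq_of_nhds, add_sub_cancel_left, add_sub_cancel_left]

lemma jetSet_mono {z₀ : Eucl n} {R R' M : ℝ} (h : R ≤ R') : jetSet z₀ R M ⊆ jetSet z₀ R' M :=
  Set.prod_mono (closedBall_subset_closedBall h) subset_rfl

/-- `φ`, with gradient `P`, is a `C²` function bounded in `C¹` by `M` on a ball. -/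
structure IsTest (z₀ : Eucl n) (R M : ℝ) (φ : Eucl n → ℝ) (P : Eucl n → Eucl n) : Prop where
  grad : ∀ x, HasGradientAt φ (P x) x
  smooth : ContDiff ℝ 1 P
  bound : ∀ x ∈ closedBall z₀ R, |φ x| ≤ M
  gradBound : ∀ x ∈ closedBall z₀ R, ‖P x‖ ≤ M

/-- Comparison of a solution with strict subsolutions. -/
lemma BdrySolution.le_of_subsolution {F : Eucl n → ℝ → Eucl n → Eucl n}
    {F₀ : Eucl n → ℝ → Eucl n → ℝ} {g u : Eucl n → ℝ} (hF : H0 F F₀) (hell : H1 F)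
    (hu : BdrySolution F F₀ g u) {z₀ : Eucl n} (hz : z₀ (Fin.last n) = 0) (hu0 : u z₀ = 0)
    {R₀ M : ℝ} (hR₀ : ‖z₀‖ + R₀ < 1) (hM : 0 < M) {L : ℝ≥0}
    (hL : LipschitzOnWith L u (closedBall (0 : Eucl n) 1 ∩ {x | 0 ≤ x (Fin.last n)}))
    (hLM : L ≤ M) :
    ∃ lam C Θ : ℝ, 0 < lam ∧ 0 < C ∧ ∀ R φ P, 0 < R → R ≤ R₀ → IsTest z₀ R M φ P →
      (∀ x : Eucl n, ‖x - z₀‖ = R → 0 ≤ x (Fin.last n) → φ x ≤ u x) →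
      (∀ x ∈ closedBall z₀ R, 0 < x (Fin.last n) → u x < φ x →
        PucciGE lam C Θ (fderiv ℝ P x)) →
      ((∀ x ∈ closedBall z₀ R, 0 ≤ x (Fin.last n) → 0 ≤ F x (φ x) (P x) (Fin.last n)) ∨
        ∀ x ∈ closedBall z₀ R, x (Fin.last n) = 0 → φ x ≤ u x) →
      ∀ x ∈ closedBall z₀ R, 0 ≤ x (Fin.last n) → φ x ≤ u x := by
  obtain ⟨C, hC0, hC⟩ := hF.exists_bound hR₀ M
  obtain ⟨lam, hlam0, hlam⟩ := hell M hM
  obtain ⟨U, hU, hUu⟩ := hL.extend_real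
  refine ⟨lam, C, (n + 1) * (C * (1 + M)) + 2 * M * C + C + 1, hlam0, hC0,
    fun R φ P hR0 hRR hT hsph hpucci hbd => ?_⟩
  have hR : ‖z₀‖ + R < 1 := by linarith
  have hmem : ∀ x ∈ closedBall z₀ R, 0 ≤ x (Fin.last n) →
      x ∈ closedBall (0 : Eucl n) 1 ∩ {x : Eucl n | 0 ≤ x (Fin.last n)} := fun x hx hxl =>
    ⟨ball_subset_closedBall (ball_subset_unit hR hx), hxl⟩
  have hmem' : ∀ x : Eucl n, ‖x - z₀‖ = R → x ∈ closedBall z₀ R := fun x hx =>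
    mem_closedBall_iff_norm.2 hx.le
  have hUM : ∀ x ∈ closedBall z₀ R, |U x| ≤ M := fun x hx => by
    have h1 := hU.dist_le_mul x z₀
    rw [← hUu (hmem z₀ (mem_closedBall_self hR0.le) hz.ge), hu0, Real.dist_eq, sub_zero] at h1
    have h2 : dist x z₀ ≤ 1 := (mem_closedBall.1 hx).trans (by linarith [norm_nonneg z₀])
    nlinarith [L.coe_nonneg]
  have key := core_comparison hF hell hz hR0 hR hM
    (fun q hq => hC q (jetSet_mono hRR hq)) hlam hLM hU hUM hT.grad hT.smooth hT.bound
    hT.gradBound (fun x hx hxl => (hUu (hmem x (hmem' x hx) hxl)) ▸ hsph x hx hxl)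
    (fun x hx hxl hlt => hpucci x hx hxl ((hUu (hmem x hx hxl.le)) ▸ hlt)) ?_ ?_
  · intro x hx hxl
    rw [hUu (hmem x hx hxl)]
    exact key x hx hxl
  · rcases hbd with hbd | hbd
    · refine ⟨0, le_rfl, fun x hx hxl hlt => ?_⟩
      rw [neg_zero, zero_mul]
      exact mul_nonneg (hbd x hx hxl) (by linarith)
    · refine ⟨C * (M + L), by positivity, fun x hx hxl hlt => ?_⟩
      have hFb : |F x (φ x) (P x) (Fin.last n)| ≤ C := (abs_apply_le_norm _ _).trans
        (hC (x, φ x, P x) ⟨closedBall_subset_closedBall hRR hx,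
          mem_closedBall_zero_iff.2 (hT.bound x hx), mem_closedBall_zero_iff.2
          (hT.gradBound x hx)⟩).2.1
      set y : Eucl n := x - x (Fin.last n) • eLast n with hy
      have hyl : y (Fin.last n) = 0 := by simp [hy, eLast_last]
      have hyR : y ∈ closedBall z₀ R := by
        rw [mem_closedBall_iff_norm] at hx ⊢
        refine le_trans ?_ hx
        rw [EuclideanSpace.norm_eq, EuclideanSpace.norm_eq]
        refine Real.sqrt_le_sqrt (Finset.sum_le_sum fun i _ => ?_)
        by_cases hi : i = Fin.last n
        · subst hi
          simp only [PiLp.sub_apply, hyl, hz, sub_zero, norm_zero]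
          rw [zero_pow two_ne_zero]
          positivity
        · simp [hy, eLast, hi]
      have hxy : dist x y = x (Fin.last n) := by
        rw [dist_eq_norm, hy, sub_sub_cancel, norm_smul, norm_eLast, mul_one,
          Real.norm_of_nonneg hxl]
      have h1 := hU.dist_le_mul x y
      rw [hxy, Real.dist_eq] at h1
      have h2 : |φ x - φ y| ≤ M * x (Fin.last n) := by
        have := (convex_closedBall z₀ R).norm_image_sub_le_of_norm_fderiv_le (𝕜 := ℝ)
          (fun w _ => (hT.grad w).differentiableAt) (C := M) (fun w hw => by
            rw [← norm_gradient_eq, (hT.grad w).gradient]; exact hT.gradBound w hw) hyR hx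
        rwa [← dist_eq_norm x y, hxy] at this
      have h3 := hbd y hyR hyl
      rw [hUu (hmem y hyR hyl.ge)] at h3
      have h4 : φ x - U x ≤ (M + L) * x (Fin.last n) := by
        linarith [(abs_le.1 h1).1, (abs_le.1 h2).2]
      have h5 : 0 ≤ φ x - U x := by linarith
      have h6 := mul_le_mul_of_nonneg_right (abs_le.1 hFb).1 h5
      have h7 := mul_le_mul_of_nonneg_left h4 C.coe_nonneg
      linarith
  · intro W K hW hW0 hWv hWeq
    have h := hu.variational hUu hU hW hR hWv 1 fun x hx => by
      have h1 := hu.1.2.2 x hx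
      have h2 := hW0 x
      linarith
    simpa using h

/-- Changing the sign of the unknown preserves the smoothness hypothesis. -/
lemma H0.neg {F : Eucl n → ℝ → Eucl n → Eucl n} {F₀ : Eucl n → ℝ → Eucl n → ℝ} (hF : H0 F F₀) :
    H0 (fun x z p => -F x (-z) (-p)) (fun x z p => -F₀ x (-z) (-p)) := by
  have hm : ContDiffOn ℝ 1 (fun q : Eucl n × ℝ × Eucl n => (q.1, -q.2.1, -q.2.2))
      (ball (0 : Eucl n) 1 ×ˢ (Set.univ : Set ℝ) ×ˢ (Set.univ : Set (Eucl n))) := by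
    fun_prop
  have hmaps : Set.MapsTo (fun q : Eucl n × ℝ × Eucl n => (q.1, -q.2.1, -q.2.2))
      (ball (0 : Eucl n) 1 ×ˢ (Set.univ : Set ℝ) ×ˢ (Set.univ : Set (Eucl n)))
      (ball (0 : Eucl n) 1 ×ˢ (Set.univ : Set ℝ) ×ˢ (Set.univ : Set (Eucl n))) :=
    fun q hq => ⟨hq.1, trivial, trivial⟩
  exact ⟨(hF.1.comp hm hmaps).neg, (hF.2.comp hm hmaps).neg⟩

lemma H1.neg {F : Eucl n → ℝ → Eucl n → Eucl n} (hell : H1 F) :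
    H1 fun x z p => -F x (-z) (-p) := by
  intro M hM
  obtain ⟨lam, hlam, h⟩ := hell M hM
  refine ⟨lam, hlam, fun x hx z hz p hp ξ => ?_⟩
  have h1 : fderiv ℝ (fun p => -F x (-z) (-p)) p = fderiv ℝ (F x (-z)) (-p) := by
    rw [fderiv_fun_neg]
    have := (ContinuousLinearEquiv.neg ℝ (M := Eucl n)).comp_right_fderiv (f := F x (-z)) (x := p)
    change fderiv ℝ (F x (-z) ∘ (ContinuousLinearEquiv.neg ℝ (M := Eucl n))) p = _ at this
    change -fderiv ℝ (F x (-z) ∘ (ContinuousLinearEquiv.neg ℝ (M := Eucl n))) p = _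
    rw [this]
    ext v
    simp
  rw [h1]
  exact h x hx (-z) (by rwa [abs_neg]) (-p) (by rwa [norm_neg]) ξ

/-- Comparison of a solution with strict supersolutions which are nonnegative on the thin ball;
`φ` is the negative of the supersolution. -/
lemma BdrySolution.ge_of_supersolution {F : Eucl n → ℝ → Eucl n → Eucl n}
    {F₀ : Eucl n → ℝ → Eucl n → ℝ} {g u : Eucl n → ℝ} (hF : H0 F F₀) (hell : H1 F)
    (hu : BdrySolution F F₀ g u) {z₀ : Eucl n} (hz : z₀ (Fin.last n) = 0) (hu0 : u z₀ = 0)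
    {R₀ M : ℝ} (hR₀ : ‖z₀‖ + R₀ < 1) (hM : 0 < M) {L : ℝ≥0}
    (hL : LipschitzOnWith L u (closedBall (0 : Eucl n) 1 ∩ {x | 0 ≤ x (Fin.last n)}))
    (hLM : L ≤ M) :
    ∃ lam C Θ : ℝ, 0 < lam ∧ 0 < C ∧ ∀ R φ P, 0 < R → R ≤ R₀ → IsTest z₀ R M φ P →
      (∀ x : Eucl n, ‖x - z₀‖ = R → 0 ≤ x (Fin.last n) → u x ≤ -φ x) →
      (∀ x ∈ closedBall z₀ R, 0 < x (Fin.last n) → PucciGE lam C Θ (fderiv ℝ P x)) →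
      (∀ x ∈ closedBall z₀ R, 0 ≤ x (Fin.last n) → F x (-φ x) (-P x) (Fin.last n) ≤ 0) →
      (∀ x ∈ closedBall z₀ R, x (Fin.last n) = 0 → φ x ≤ 0) →
      ∀ x ∈ closedBall z₀ R, 0 ≤ x (Fin.last n) → u x ≤ -φ x := by
  obtain ⟨C, hC0, hC⟩ := hF.neg.exists_bound hR₀ M
  obtain ⟨lam, hlam0, hlam⟩ := hell.neg M hM
  obtain ⟨U, hU, hUu⟩ := hL.extend_real
  refine ⟨lam, C, (n + 1) * (C * (1 + M)) + 2 * M * C + C + 1, hlam0, hC0,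
    fun R φ P hR0 hRR hT hsph hpucci hbd hthin => ?_⟩
  have hR : ‖z₀‖ + R < 1 := by linarith
  have hmem : ∀ x ∈ closedBall z₀ R, 0 ≤ x (Fin.last n) →
      x ∈ closedBall (0 : Eucl n) 1 ∩ {x : Eucl n | 0 ≤ x (Fin.last n)} := fun x hx hxl =>
    ⟨ball_subset_closedBall (ball_subset_unit hR hx), hxl⟩
  have hmem' : ∀ x : Eucl n, ‖x - z₀‖ = R → x ∈ closedBall z₀ R := fun x hx =>
    mem_closedBall_iff_norm.2 hx.le
  have hUM : ∀ x ∈ closedBall z₀ R, |-U x| ≤ M := fun x hx => by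
    have h1 := hU.dist_le_mul x z₀
    rw [← hUu (hmem z₀ (mem_closedBall_self hR0.le) hz.ge), hu0, Real.dist_eq, sub_zero] at h1
    have h2 : dist x z₀ ≤ 1 := (mem_closedBall.1 hx).trans (by linarith [norm_nonneg z₀])
    rw [abs_neg]
    nlinarith [L.coe_nonneg]
  have hgrad : ∀ x, gradient (fun y => -U y) x = -gradient U x := fun x => by
    rw [gradient, fderiv_fun_neg, map_neg, ← gradient]
  have hU' : LipschitzWith L fun y => -U y := hU.neg
  have key := core_comparison (U := fun y => -U y) hF.neg hell.neg hz hR0 hR hM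
    (fun q hq => hC q (jetSet_mono hRR hq)) hlam hLM hU' hUM hT.grad hT.smooth hT.bound
    hT.gradBound (fun x hx hxl => by
      have := hsph x hx hxl
      rw [hUu (hmem x (hmem' x hx) hxl)] at this
      linarith)
    (fun x hx hxl _ => hpucci x hx hxl) ?_ ?_
  · intro x hx hxl
    rw [hUu (hmem x hx hxl)]
    linarith [key x hx hxl]
  · refine ⟨0, le_rfl, fun x hx hxl hlt => ?_⟩
    rw [neg_zero, zero_mul]
    have := hbd x hx hxl
    exact mul_nonneg (by rw [PiLp.neg_apply]; linarith) (by linarith)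
  · intro W K hW hW0 hWv hWeq
    have h := hu.variational hUu hU hW hR hWv (-1) fun x hx => by
      have h1 := hu.1.2.2 x hx
      by_cases hxR : ‖x - z₀‖ ≤ R
      · have hxl : x (Fin.last n) = 0 := hx.2
        have hxc := mem_closedBall_iff_norm.2 hxR
        rw [hWeq x hxR hxl.ge]
        have h3 := hthin x hxc hxl
        rw [hUu (hmem x hxc hxl.ge)] at h1 ⊢
        have : max (φ x - -U x) 0 ≤ U x := max_le (by linarith) h1
        linarith
      · rw [hWv x (not_le.1 hxR).le]
        linarith
    refine h.trans (le_of_eq (integral_congr_ae (Filter.Eventually.of_forall fun x => ?_)))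
    simp only [hgrad, neg_neg, inner_neg_left, inner_smul_right]
    ring

lemma inner_eLast (v : Eucl n) : ⟪eLast n, v⟫_ℝ = v (Fin.last n) := by
  rw [eLast, EuclideanSpace.inner_single_left]
  simp

lemma proj_last_apply (v : Eucl n) :
    (EuclideanSpace.proj (Fin.last n) : Eucl n →L[ℝ] ℝ) v = v (Fin.last n) := rfl

lemma hasFDerivAt_last (x : Eucl n) : HasFDerivAt (fun x : Eucl n => x (Fin.last n))
    (EuclideanSpace.proj (Fin.last n) : Eucl n →L[ℝ] ℝ) x :=
  (EuclideanSpace.proj (Fin.last n) : Eucl n →L[ℝ] ℝ).hasFDerivAt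

/-- A lower bound for the trace against a rank one matrix minus a small one. -/
lemma pucciGE_of_rankOne {lam C Θ ρ a b : ℝ} (hρ : 0 ≤ ρ) (ha : 0 ≤ a) (hb : 0 ≤ b)
    {w : Eucl n} {B : Eucl n →L[ℝ] Eucl n}
    (hB : ∀ v, B v = (ρ * ⟪w, v⟫_ℝ) • w - (a • v + (b * v (Fin.last n)) • eLast n))
    (hΘ : Θ ≤ ρ * (lam * ‖w‖ ^ 2) - ((n + 1) * a + b) * C) : PucciGE lam C Θ B := by
  intro A hA hAC
  have hAi : ∀ v : Eucl n, ‖v‖ = 1 → ∀ i, (A v) i ≤ C := fun v hv i =>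
    (le_abs_self _).trans ((abs_apply_le_norm _ i).trans
      ((A.le_opNorm v).trans (by rw [hv, mul_one]; exact hAC)))
  have hterm : ∀ i : Fin (n + 1), A (B (EuclideanSpace.single i 1)) i =
      ρ * ((A w) i * w i) - a * (A (EuclideanSpace.single i 1)) i -
        b * ((EuclideanSpace.single i (1 : ℝ) : Eucl n) (Fin.last n) * (A (eLast n)) i) := by
    intro i
    rw [hB, EuclideanSpace.inner_single_right]
    simp only [map_sub, map_add, map_smul, PiLp.sub_apply, PiLp.add_apply, PiLp.smul_apply,
      smul_eq_mul, conj_trivial, one_mul]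
    ring
  rw [Finset.sum_congr rfl fun i _ => hterm i, Finset.sum_sub_distrib, Finset.sum_sub_distrib,
    ← Finset.mul_sum, ← Finset.mul_sum, ← Finset.mul_sum, ← inner_eq_sum]
  have h1 := mul_le_mul_of_nonneg_left (hA w) hρ
  have h2 : ∑ i, (A (EuclideanSpace.single i 1)) i ≤ (n + 1) * C := by
    calc ∑ i, (A (EuclideanSpace.single i 1)) i ≤ ∑ _i : Fin (n + 1), C :=
          Finset.sum_le_sum fun i _ => hAi _ (by simp) i
      _ = (n + 1) * C := by simp
  have h3 : ∑ i, (EuclideanSpace.single i (1 : ℝ) : Eucl n) (Fin.last n) * (A (eLast n)) i ≤ C := by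
    rw [Finset.sum_eq_single (Fin.last n)]
    · simpa using hAi _ norm_eLast (Fin.last n)
    · intro i _ hi
      simp [Ne.symm hi]
    · simp
  have h4 := mul_le_mul_of_nonneg_left h2 ha
  have h5 := mul_le_mul_of_nonneg_left h3 hb
  linarith

/-- The quadratic barrier. -/
def quadBarrier (m t K γ : ℝ) (y x : Eucl n) : ℝ :=
  m * x (Fin.last n) + t * (K * x (Fin.last n) ^ 2 - ‖x - y‖ ^ 2) + γ

/-- The gradient of the quadratic barrier. -/
def quadBarrierGrad (m t K : ℝ) (y x : Eucl n) : Eucl n :=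
  m • eLast n + (2 * t) • ((K * x (Fin.last n)) • eLast n - (x - y))

lemma hasGradientAt_quadBarrier (m t K γ : ℝ) (y x : Eucl n) :
    HasGradientAt (quadBarrier m t K γ y) (quadBarrierGrad m t K y x) x := by
  rw [hasGradientAt_iff_hasFDerivAt]
  have h1 := hasFDerivAt_last x
  have h2 := ((hasFDerivAt_id x).sub_const y).norm_sq
  have h3 := ((h1.const_mul m).add ((((h1.pow 2).const_mul K).sub h2).const_mul t)).add_const γ
  refine h3.congr_fderiv ?_
  ext v
  simp only [quadBarrierGrad, map_add, map_smul, map_sub, add_apply,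
    smul_apply, sub_apply,
    InnerProductSpace.toDual_apply_apply, inner_eLast, ContinuousLinearMap.comp_apply, id_eq,
    ContinuousLinearMap.id_apply, innerSL_apply_apply, proj_last_apply, smul_eq_mul,
    nsmul_eq_mul]
  push_cast
  ring

lemma contDiff_quadBarrierGrad (m t K : ℝ) (y : Eucl n) :
    ContDiff ℝ 1 (quadBarrierGrad m t K y) := by
  unfold quadBarrierGrad
  fun_prop

lemma fderiv_quadBarrierGrad (m t K : ℝ) (y x v : Eucl n) :
    fderiv ℝ (quadBarrierGrad m t K y) x v =
      (2 * t) • ((K * v (Fin.last n)) • eLast n - v) := by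
  have h1 := hasFDerivAt_last x
  have h2 := ((((h1.const_mul K).smul_const (eLast n)).sub
    ((hasFDerivAt_id x).sub_const y)).const_smul (2 * t)).const_add (m • eLast n)
  have h3 : HasFDerivAt (quadBarrierGrad m t K y) _ x := h2
  rw [h3.fderiv]
  simp

lemma pucciGE_quadBarrier {lam C Θ m t K : ℝ} (ht : 0 ≤ t) (hK : 0 ≤ K) (y x : Eucl n)
    (hΘ : Θ ≤ 2 * t * (K * lam - (n + 1) * C)) :
    PucciGE lam C Θ (fderiv ℝ (quadBarrierGrad m t K y) x) := by
  refine pucciGE_of_rankOne (ρ := 2 * t * K) (a := 2 * t) (b := 0) (w := eLast n) (by positivity)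
    (by positivity) le_rfl (fun v => ?_) ?_
  · rw [fderiv_quadBarrierGrad, inner_eLast, zero_mul, zero_smul, add_zero]
    module
  · rw [norm_eLast]
    linarith

/-- An ellipsoidal quadratic form centred at `y`. -/
def ellip (a b : ℝ) (y x : Eucl n) : ℝ :=
  a * ‖x - y‖ ^ 2 + (b - a) * (x (Fin.last n) - y (Fin.last n)) ^ 2

/-- Half of the gradient of `ellip`. -/
def ellipGrad (a b : ℝ) (y x : Eucl n) : Eucl n :=
  a • (x - y) + ((b - a) * (x (Fin.last n) - y (Fin.last n))) • eLast n

lemma hasFDerivAt_ellip (a b : ℝ) (y x : Eucl n) :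
    HasFDerivAt (ellip a b y) ((2 : ℝ) • innerSL ℝ (ellipGrad a b y x)) x := by
  have h1 := (hasFDerivAt_last x).sub_const (y (Fin.last n))
  have h2 := ((hasFDerivAt_id x).sub_const y).norm_sq
  have h3 := (h2.const_mul a).add ((h1.pow 2).const_mul (b - a))
  refine h3.congr_fderiv ?_
  ext v
  simp only [ellipGrad, map_add, map_smul, map_sub, add_apply,
    smul_apply, sub_apply,
    inner_eLast, ContinuousLinearMap.comp_apply, id_eq,
    ContinuousLinearMap.id_apply, innerSL_apply_apply, proj_last_apply, smul_eq_mul,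
    nsmul_eq_mul]
  push_cast
  ring

/-- The Gaussian barrier. -/
def gaussBarrier (m κ α a b : ℝ) (y x : Eucl n) : ℝ :=
  m * x (Fin.last n) + κ * (Real.exp (-α * ellip a b y x) - Real.exp (-α))

/-- The gradient of the Gaussian barrier. -/
def gaussBarrierGrad (m κ α a b : ℝ) (y x : Eucl n) : Eucl n :=
  m • eLast n + (-(2 * α * κ) * Real.exp (-α * ellip a b y x)) • ellipGrad a b y x

lemma hasGradientAt_gaussBarrier (m κ α a b : ℝ) (y x : Eucl n) :
    HasGradientAt (gaussBarrier m κ α a b y) (gaussBarrierGrad m κ α a b y x) x := by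
  rw [hasGradientAt_iff_hasFDerivAt]
  have h1 := ((hasFDerivAt_ellip a b y x).const_mul (-α)).exp
  have h3 := ((hasFDerivAt_last x).const_mul m).add
    ((h1.sub_const (Real.exp (-α))).const_mul κ)
  refine h3.congr_fderiv ?_
  ext v
  simp only [gaussBarrierGrad, map_add, map_smul, add_apply, smul_apply,
    InnerProductSpace.toDual_apply_apply, inner_eLast, innerSL_apply_apply,
    proj_last_apply, smul_eq_mul]
  ring

lemma contDiff_gaussBarrierGrad (m κ α a b : ℝ) (y : Eucl n) :
    ContDiff ℝ 1 (gaussBarrierGrad m κ α a b y) := by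
  unfold gaussBarrierGrad ellip ellipGrad
  have : ContDiff ℝ 1 fun x : Eucl n => ‖x - y‖ ^ 2 := (contDiff_id.sub contDiff_const).norm_sq ℝ
  fun_prop

lemma fderiv_gaussBarrierGrad (m κ α a b : ℝ) (y x v : Eucl n) :
    fderiv ℝ (gaussBarrierGrad m κ α a b y) x v =
      (4 * α ^ 2 * κ * Real.exp (-α * ellip a b y x) * ⟪ellipGrad a b y x, v⟫_ℝ) •
        ellipGrad a b y x - ((2 * α * κ * Real.exp (-α * ellip a b y x) * a) • v +
        (2 * α * κ * Real.exp (-α * ellip a b y x) * (b - a) * v (Fin.last n)) • eLast n) := by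
  have h1 := (((hasFDerivAt_ellip a b y x).const_mul (-α)).exp).const_mul (-(2 * α * κ))
  have h2 : HasFDerivAt (ellipGrad a b y) _ x :=
    (((hasFDerivAt_id x).sub_const y).const_smul a).add
      ((((hasFDerivAt_last x).sub_const (y (Fin.last n))).const_mul (b - a)).smul_const (eLast n))
  have h3 : HasFDerivAt (gaussBarrierGrad m κ α a b y) _ x := (h1.smul h2).const_add (m • eLast n)
  rw [h3.fderiv]
  simp only [add_apply,
    smul_apply, ContinuousLinearMap.smulRight_apply,
    ContinuousLinearMap.id_apply, innerSL_apply_apply, proj_last_apply, smul_eq_mul]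
  module

lemma pucciGE_gaussBarrier {lam C Θ m κ α a b : ℝ} (hκ : 0 ≤ κ) (hα : 0 ≤ α) (ha : 0 ≤ a)
    (hab : a ≤ b) (hC : 0 ≤ C) (y x : Eucl n)
    (hΘ : Θ ≤ 2 * α * κ * Real.exp (-α * ellip a b y x) *
      (2 * α * (lam * ‖ellipGrad a b y x‖ ^ 2) - (n + 1) * (b * C))) :
    PucciGE lam C Θ (fderiv ℝ (gaussBarrierGrad m κ α a b y) x) := by
  have hE := (Real.exp_pos (-α * ellip a b y x)).le
  have hba := sub_nonneg.2 hab
  refine pucciGE_of_rankOne (by positivity) (by positivity) (by positivity)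
    (fderiv_gaussBarrierGrad m κ α a b y x) (hΘ.trans ?_)
  have hs : (n + 1) * a + (b - a) ≤ (n + 1) * b := by
    have hn : (0 : ℝ) ≤ n := by positivity
    nlinarith
  have h0 : 0 ≤ 2 * α * κ * Real.exp (-α * ellip a b y x) * C := by positivity
  have := mul_le_mul_of_nonneg_left hs h0
  linarith

lemma mul_norm_sq_le_ellip {a b : ℝ} (hab : a ≤ b) (y x : Eucl n) :
    a * ‖x - y‖ ^ 2 ≤ ellip a b y x := by
  have := mul_nonneg (sub_nonneg.2 hab) (sq_nonneg (x (Fin.last n) - y (Fin.last n)))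
  unfold ellip
  linarith

lemma last_sub_sq_le (x y : Eucl n) :
    (x (Fin.last n) - y (Fin.last n)) ^ 2 ≤ ‖x - y‖ ^ 2 := by
  rw [← sq_abs]
  exact pow_le_pow_left₀ (abs_nonneg _) (by simpa using abs_apply_le_norm (x - y) (Fin.last n)) 2

lemma mul_last_sq_le_ellip {a b : ℝ} (ha : 0 ≤ a) (y x : Eucl n) :
    b * (x (Fin.last n) - y (Fin.last n)) ^ 2 ≤ ellip a b y x := by
  have := mul_le_mul_of_nonneg_left (last_sub_sq_le x y) ha
  unfold ellip
  linarith

lemma le_norm_ellipGrad_sq {a b : ℝ} (ha : 0 ≤ a) (hab : a ≤ b) (y x : Eucl n) :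
    (a * ‖x - y‖) ^ 2 ≤ ‖ellipGrad a b y x‖ ^ 2 := by
  have h1 : ⟪x - y, eLast n⟫_ℝ = x (Fin.last n) - y (Fin.last n) := by
    rw [real_inner_comm, inner_eLast, PiLp.sub_apply]
  have h2 := sub_nonneg.2 hab
  rw [ellipGrad, norm_add_sq_real, real_inner_smul_left, real_inner_smul_right, h1, norm_smul,
    Real.norm_of_nonneg ha]
  have : 0 ≤ a * ((b - a) * (x (Fin.last n) - y (Fin.last n)) ^ 2) := by positivity
  nlinarith [sq_nonneg ‖((b - a) * (x (Fin.last n) - y (Fin.last n))) • eLast n‖]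

lemma norm_ellipGrad_le {a b : ℝ} (ha : 0 ≤ a) (hab : a ≤ b) (y x : Eucl n) :
    ‖ellipGrad a b y x‖ ≤ b * ‖x - y‖ := by
  refine (norm_add_le _ _).trans ?_
  have h2 := sub_nonneg.2 hab
  rw [norm_smul, norm_smul, norm_eLast, mul_one, Real.norm_of_nonneg ha, norm_mul,
    Real.norm_of_nonneg h2, Real.norm_eq_abs]
  have h1 : |x (Fin.last n) - y (Fin.last n)| ≤ ‖x - y‖ := by
    simpa using abs_apply_le_norm (x - y) (Fin.last n)
  nlinarith [mul_le_mul_of_nonneg_left h1 h2]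

/-- The comparison principle for test functions lying below `u` on the thin ball. -/
def LowerComparison (u : Eucl n → ℝ) (z₀ : Eucl n) (R₀ M lam C Θ : ℝ) : Prop :=
  ∀ (R : ℝ) (φ : Eucl n → ℝ) (P : Eucl n → Eucl n), 0 < R → R ≤ R₀ → IsTest z₀ R M φ P →
    (∀ x, ‖x - z₀‖ = R → 0 ≤ x (Fin.last n) → φ x ≤ u x) →
    (∀ x ∈ closedBall z₀ R, 0 < x (Fin.last n) → u x < φ x → PucciGE lam C Θ (fderiv ℝ P x)) →
    (∀ x ∈ closedBall z₀ R, x (Fin.last n) = 0 → φ x ≤ u x) →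
    ∀ x ∈ closedBall z₀ R, 0 ≤ x (Fin.last n) → φ x ≤ u x

set_option maxHeartbeats 1000000 in
/-- Propagation of a gap between `u` and a linear function from a ball to an ellipsoid. -/
lemma LowerComparison.ellip_propagation {u : Eucl n → ℝ} {z₀ : Eucl n}
    {R₀ M lam C Θ L θ σ : ℝ} (hcomp : LowerComparison u z₀ R₀ M lam C Θ) (hR₀ : 0 < R₀)
    (hz : z₀ (Fin.last n) = 0) (hlam : 0 < lam) (hC : 0 < C) (hL : 0 ≤ L) (hLM : L + 2 ≤ M)
    (hθ : 0 < θ) (hσ : 0 < σ) :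
    ∃ c > 0, ∃ r₁ > 0, ∀ r m a s : ℝ, ∀ y : Eucl n, 0 < r → r < r₁ → |m| ≤ L + 1 →
      y (Fin.last n) = s → θ * r ≤ s → ‖y - z₀‖ ≤ 4 * r → 1 / (16 * r ^ 2) ≤ a → a ≤ 1 / s ^ 2 →
      (∀ x ∈ closedBall z₀ (8 * r), 0 ≤ x (Fin.last n) → m * x (Fin.last n) ≤ u x) →
      (∀ x, ‖x - y‖ ≤ θ * r → 0 ≤ x (Fin.last n) → m * x (Fin.last n) + σ * r ≤ u x) →
      ∀ x, 0 ≤ x (Fin.last n) → ellip a (1 / s ^ 2) y x ≤ 1 →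
        m * x (Fin.last n) + c * r * (1 - ellip a (1 / s ^ 2) y x) ≤ u x := by
  obtain ⟨α, hα, hα1⟩ : ∃ α > 0, 2 * α * (lam * (θ ^ 2 / 256)) - (n + 1) * (C / θ ^ 2) = 1 := by
    refine ⟨(1 + (n + 1) * (C / θ ^ 2)) / (2 * (lam * (θ ^ 2 / 256))), by positivity, ?_⟩
    field_simp
    ring
  obtain ⟨c₀, hc₀, hc₀σ, hc₀1, hc₀α⟩ : ∃ c₀ > 0, c₀ ≤ σ ∧ c₀ ≤ 1 ∧
      2 * α * c₀ * (12 / θ ^ 2) ≤ 1 := by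
    refine ⟨min (min σ 1) (θ ^ 2 / (24 * α)), by positivity, (min_le_left _ _).trans
      (min_le_left _ _), (min_le_left _ _).trans (min_le_right _ _), ?_⟩
    calc 2 * α * min (min σ 1) (θ ^ 2 / (24 * α)) * (12 / θ ^ 2)
        ≤ 2 * α * (θ ^ 2 / (24 * α)) * (12 / θ ^ 2) := by gcongr; exact min_le_right _ _
      _ = 1 := by field_simp; norm_num
  refine ⟨c₀ * α * Real.exp (-α), by positivity,
    min (min (R₀ / 8) (1 / 8)) (2 * α * c₀ * Real.exp (-α) / (|Θ| + 1)), by positivity, ?_⟩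
  intro r m a s y hr hr₁ hm hys hθs hyz ha hab hball hgap x hx hq
  simp only [lt_min_iff] at hr₁
  obtain ⟨⟨hrR, hr8⟩, hrΘ⟩ := hr₁
  rw [lt_div_iff₀ (by positivity)] at hrΘ
  have hs : 0 < s := lt_of_lt_of_le (by positivity) hθs
  have ha0 : 0 < a := lt_of_lt_of_le (by positivity) ha
  set b := 1 / s ^ 2 with hb
  have hbθ : b ≤ 1 / (θ ^ 2 * r ^ 2) := by
    rw [hb, ← mul_pow]
    gcongr
  have hqnn : ∀ x, 0 ≤ ellip a b y x := fun x =>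
    (by positivity : 0 ≤ a * ‖x - y‖ ^ 2).trans (mul_norm_sq_le_ellip hab y x)
  have hfar : ∀ x : Eucl n, 4 * r ≤ ‖x - y‖ → 1 ≤ ellip a b y x := by
    intro x hx
    refine le_trans ?_ (mul_norm_sq_le_ellip hab y x)
    calc 1 = 1 / (16 * r ^ 2) * (4 * r) ^ 2 := by field_simp; norm_num
      _ ≤ a * ‖x - y‖ ^ 2 := by gcongr
  have hthin : ∀ x : Eucl n, x (Fin.last n) = 0 → 1 ≤ ellip a b y x := by
    intro x hx
    refine le_trans (le_of_eq ?_) (mul_last_sq_le_ellip ha0.le y x)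
    rw [hx, hys, hb]
    field_simp
    ring
  have hexp : ∀ q : ℝ, 1 ≤ q → c₀ * r * (Real.exp (-α * q) - Real.exp (-α)) ≤ 0 := by
    intro q hq
    refine mul_nonpos_of_nonneg_of_nonpos (by positivity) (sub_nonpos.2 (Real.exp_le_exp.2 ?_))
    nlinarith
  have hnear : ∀ x ∈ closedBall z₀ (8 * r), ‖x - y‖ ≤ 12 * r := by
    intro x hx
    rw [mem_closedBall, dist_eq_norm] at hx
    calc ‖x - y‖ = ‖(x - z₀) - (y - z₀)‖ := by congr 1; abel
      _ ≤ ‖x - z₀‖ + ‖y - z₀‖ := norm_sub_le _ _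
      _ ≤ 12 * r := by linarith
  have hxl : ∀ x ∈ closedBall z₀ (8 * r), |x (Fin.last n)| ≤ 8 * r := by
    intro x hx
    rw [mem_closedBall, dist_eq_norm] at hx
    have := abs_apply_le_norm (x - z₀) (Fin.last n)
    rw [PiLp.sub_apply, hz, sub_zero] at this
    exact this.trans hx
  have hbump : ∀ x : Eucl n, |Real.exp (-α * ellip a b y x) - Real.exp (-α)| ≤ 1 := by
    intro x
    have h1 : Real.exp (-α * ellip a b y x) ≤ 1 :=
      Real.exp_le_one_iff.2 (by nlinarith [hqnn x])
    have h2 : Real.exp (-α) ≤ 1 := Real.exp_le_one_iff.2 (by linarith)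
    rw [abs_le]
    constructor <;> linarith [Real.exp_pos (-α * ellip a b y x), Real.exp_pos (-α)]
  have key := hcomp (8 * r) (gaussBarrier m (c₀ * r) α a b y)
    (gaussBarrierGrad m (c₀ * r) α a b y) (by positivity) (by linarith)
    { grad := hasGradientAt_gaussBarrier m (c₀ * r) α a b y
      smooth := contDiff_gaussBarrierGrad m (c₀ * r) α a b y
      bound := fun x hx => by
        have h1 := hxl x hx
        calc |gaussBarrier m (c₀ * r) α a b y x|
            ≤ |m| * |x (Fin.last n)| +
              c₀ * r * |Real.exp (-α * ellip a b y x) - Real.exp (-α)| := by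
              refine (abs_add_le _ _).trans ?_
              rw [abs_mul, abs_mul, abs_of_pos (by positivity : 0 < c₀ * r)]
          _ ≤ (L + 1) * 1 + 1 * 1 * 1 := by
              gcongr
              · linarith
              · linarith
              · exact hbump x
          _ ≤ M := by linarith
      gradBound := fun x hx => by
        have h1 : Real.exp (-α * ellip a b y x) ≤ 1 :=
          Real.exp_le_one_iff.2 (by nlinarith [hqnn x])
        have h2 : ‖ellipGrad a b y x‖ ≤ 1 / (θ ^ 2 * r ^ 2) * (12 * r) :=
          (norm_ellipGrad_le ha0.le hab y x).trans (by gcongr; exact hnear x hx)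
        calc ‖gaussBarrierGrad m (c₀ * r) α a b y x‖
            ≤ |m| + 2 * α * (c₀ * r) * Real.exp (-α * ellip a b y x) *
              ‖ellipGrad a b y x‖ := by
              refine (norm_add_le _ _).trans (le_of_eq ?_)
              rw [norm_smul, norm_smul, norm_eLast, mul_one, norm_mul, norm_neg,
                Real.norm_of_nonneg (Real.exp_pos _).le,
                Real.norm_of_nonneg (by positivity : 0 ≤ 2 * α * (c₀ * r)), Real.norm_eq_abs]
          _ ≤ (L + 1) + 2 * α * (c₀ * r) * 1 * (1 / (θ ^ 2 * r ^ 2) * (12 * r)) := by gcongr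
          _ = (L + 1) + 2 * α * c₀ * (12 / θ ^ 2) := by field_simp
          _ ≤ M := by linarith }
    (fun x hx hxl => ?_) (fun x hx hxl hlt => ?_) (fun x hx hxl => ?_)
  · have hxb : x ∈ closedBall z₀ (8 * r) := by
      rw [mem_closedBall, dist_eq_norm]
      have h1 : ‖x - y‖ ≤ 4 * r := by
        by_contra! h
        have := mul_norm_sq_le_ellip hab y x
        have h3 : 1 < a * ‖x - y‖ ^ 2 := by
          calc 1 = 1 / (16 * r ^ 2) * (4 * r) ^ 2 := by field_simp; norm_num
            _ ≤ a * (4 * r) ^ 2 := by gcongr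
            _ < a * ‖x - y‖ ^ 2 := by gcongr
        linarith
      calc ‖x - z₀‖ = ‖(x - y) + (y - z₀)‖ := by congr 1; abel
        _ ≤ ‖x - y‖ + ‖y - z₀‖ := norm_add_le _ _
        _ ≤ 8 * r := by linarith
    refine le_trans ?_ (key x hxb hx)
    have h1 : α * (1 - ellip a b y x) * Real.exp (-α) ≤
        Real.exp (-α * ellip a b y x) - Real.exp (-α) := by
      have h2 : Real.exp (-α * ellip a b y x) =
          Real.exp (α * (1 - ellip a b y x)) * Real.exp (-α) := by
        rw [← Real.exp_add]
        ring_nf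
      rw [h2]
      nlinarith [Real.add_one_le_exp (α * (1 - ellip a b y x)), Real.exp_pos (-α)]
    have h2 := mul_le_mul_of_nonneg_left h1 (by positivity : 0 ≤ c₀ * r)
    unfold gaussBarrier
    linarith
  · have h1 : 4 * r ≤ ‖x - y‖ := by
      have : ‖x - z₀‖ ≤ ‖x - y‖ + ‖y - z₀‖ := by
        calc ‖x - z₀‖ = ‖(x - y) + (y - z₀)‖ := by congr 1; abel
          _ ≤ _ := norm_add_le _ _
      linarith
    have h2 := hexp _ (hfar x h1)
    have h3 := hball x (by rw [mem_closedBall, dist_eq_norm, hx]) hxl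
    unfold gaussBarrier
    linarith
  · have hq1 : ellip a b y x ≤ 1 := by
      by_contra! h
      have := hexp _ h.le
      have h3 := hball x hx hxl.le
      unfold gaussBarrier at hlt
      linarith
    have hxy : θ * r < ‖x - y‖ := by
      by_contra! h
      have h3 := hgap x h hxl.le
      have h4 := mul_le_mul_of_nonneg_left ((le_abs_self _).trans (hbump x))
        (by positivity : 0 ≤ c₀ * r)
      have h5 := mul_le_mul_of_nonneg_right hc₀σ hr.le
      unfold gaussBarrier at hlt
      linarith
    refine pucciGE_gaussBarrier (by positivity) hα.le ha0.le hab hC.le y x ?_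
    have h1 : θ ^ 2 / 256 / r ^ 2 ≤ ‖ellipGrad a b y x‖ ^ 2 := by
      refine le_trans ?_ (le_norm_ellipGrad_sq ha0.le hab y x)
      calc θ ^ 2 / 256 / r ^ 2 = (1 / (16 * r ^ 2) * (θ * r)) ^ 2 := by field_simp; norm_num
        _ ≤ (a * ‖x - y‖) ^ 2 := by gcongr
    have h2 : 1 / r ^ 2 ≤ 2 * α * (lam * ‖ellipGrad a b y x‖ ^ 2) - (n + 1) * (b * C) := by
      calc 1 / r ^ 2 = (2 * α * (lam * (θ ^ 2 / 256)) - (n + 1) * (C / θ ^ 2)) / r ^ 2 := by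
            rw [hα1]
        _ = 2 * α * (lam * (θ ^ 2 / 256 / r ^ 2)) - (n + 1) * (1 / (θ ^ 2 * r ^ 2) * C) := by
            field_simp
        _ ≤ _ := by gcongr
    have h3 : Real.exp (-α) ≤ Real.exp (-α * ellip a b y x) :=
      Real.exp_le_exp.2 (by nlinarith)
    calc Θ ≤ |Θ| + 1 := by linarith [le_abs_self Θ]
      _ ≤ 2 * α * c₀ * Real.exp (-α) / r := by
          rw [le_div_iff₀ hr]
          linarith
      _ = 2 * α * (c₀ * r) * Real.exp (-α) * (1 / r ^ 2) := by field_simp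
      _ ≤ _ := by gcongr
  · have h2 := hexp _ (hthin x hxl)
    have h3 := hball x hx hxl.ge
    unfold gaussBarrier
    linarith

lemma norm_sub_last_smul_le (v : Eucl n) : ‖v - v (Fin.last n) • eLast n‖ ≤ ‖v‖ := by
  refine le_of_sq_le_sq ?_ (norm_nonneg v)
  rw [norm_sub_sq_real, real_inner_smul_right, real_inner_comm, inner_eLast, norm_smul,
    norm_eLast, mul_one, Real.norm_eq_abs, sq_abs]
  nlinarith [sq_nonneg (v (Fin.last n))]

/-- `u` is Lipschitz in a half ball centred at a zero, and nonnegative on its thin part. -/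
structure IsSignoriniAt (u : Eucl n → ℝ) (z₀ : Eucl n) (R₀ L : ℝ) : Prop where
  last : z₀ (Fin.last n) = 0
  zero : u z₀ = 0
  lip : ∀ x ∈ closedBall z₀ R₀, 0 ≤ x (Fin.last n) → ∀ y ∈ closedBall z₀ R₀,
    0 ≤ y (Fin.last n) → |u x - u y| ≤ L * ‖x - y‖
  nonneg : ∀ x ∈ closedBall z₀ R₀, x (Fin.last n) = 0 → 0 ≤ u x

/-- `m` is the slope of a linear function lying below `u` near `z₀`. -/
def IsLowerSlope (u : Eucl n → ℝ) (z₀ : Eucl n) (m : ℝ) : Prop :=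
  ∃ r > 0, ∀ x ∈ closedBall z₀ r, 0 ≤ x (Fin.last n) → m * x (Fin.last n) ≤ u x

lemma add_smul_eLast_mem {z₀ : Eucl n} {t r : ℝ} (ht : 0 ≤ t) (htr : t ≤ r) :
    z₀ + t • eLast n ∈ closedBall z₀ r := by
  rw [mem_closedBall, dist_eq_norm, add_sub_cancel_left, norm_smul, norm_eLast, mul_one,
    Real.norm_of_nonneg ht]
  exact htr

lemma add_smul_eLast_last (x : Eucl n) (t : ℝ) :
    (x + t • eLast n) (Fin.last n) = x (Fin.last n) + t := by
  simp [eLast_last]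

lemma IsSignoriniAt.isLowerSlope {u : Eucl n → ℝ} {z₀ : Eucl n} {R₀ L : ℝ}
    (h : IsSignoriniAt u z₀ R₀ L) (hR₀ : 0 < R₀) : IsLowerSlope u z₀ (-L) := by
  refine ⟨R₀, hR₀, fun x hx hxl => ?_⟩
  have hl : (x - x (Fin.last n) • eLast n) (Fin.last n) = 0 := by simp [eLast_last]
  have hm : x - x (Fin.last n) • eLast n ∈ closedBall z₀ R₀ := by
    rw [mem_closedBall, dist_eq_norm] at hx ⊢
    refine le_trans (le_of_eq_of_le ?_ (norm_sub_last_smul_le (x - z₀))) hx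
    rw [PiLp.sub_apply, h.last, sub_zero]
    congr 1
    abel
  have h1 := h.lip x hx hxl _ hm hl.ge
  have h2 := h.nonneg _ hm hl
  rw [sub_sub_cancel, norm_smul, norm_eLast, mul_one, Real.norm_of_nonneg hxl] at h1
  linarith [(abs_le.1 h1).1]

lemma IsSignoriniAt.slope_le {u : Eucl n → ℝ} {z₀ : Eucl n} {R₀ L m : ℝ}
    (h : IsSignoriniAt u z₀ R₀ L) (hR₀ : 0 < R₀) (hm : IsLowerSlope u z₀ m) : m ≤ L := by
  obtain ⟨r, hr, hmr⟩ := hm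
  have ht : 0 < min r R₀ := lt_min hr hR₀
  have hl : (z₀ + min r R₀ • eLast n) (Fin.last n) = min r R₀ := by
    rw [add_smul_eLast_last, h.last, zero_add]
  have h1 := hmr _ (add_smul_eLast_mem ht.le (min_le_left _ _)) (hl.symm ▸ ht.le)
  have h2 := h.lip _ (add_smul_eLast_mem ht.le (min_le_right _ _)) (hl.symm ▸ ht.le) z₀
    (mem_closedBall_self hR₀.le) h.last.ge
  rw [add_sub_cancel_left, norm_smul, norm_eLast, mul_one, Real.norm_of_nonneg ht.le, h.zero,
    sub_zero] at h2
  rw [hl] at h1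
  have := h1.trans ((le_abs_self _).trans h2)
  exact le_of_mul_le_mul_right this ht

/-- The optimal lower slope. -/
lemma IsSignoriniAt.exists_slope {u : Eucl n → ℝ} {z₀ : Eucl n} {R₀ L : ℝ}
    (h : IsSignoriniAt u z₀ R₀ L) (hR₀ : 0 < R₀) :
    ∃ d : ℝ, |d| ≤ L ∧ (∀ η > 0, IsLowerSlope u z₀ (d - η)) ∧
      ∀ m, IsLowerSlope u z₀ m → m ≤ d := by
  have hne : {m | IsLowerSlope u z₀ m}.Nonempty := ⟨-L, h.isLowerSlope hR₀⟩
  have hbd : BddAbove {m | IsLowerSlope u z₀ m} := ⟨L, fun m hm => h.slope_le hR₀ hm⟩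
  refine ⟨sSup {m | IsLowerSlope u z₀ m}, abs_le.2 ⟨le_csSup hbd (h.isLowerSlope hR₀),
    csSup_le hne fun m hm => h.slope_le hR₀ hm⟩, fun η hη => ?_, fun m hm => le_csSup hbd hm⟩
  obtain ⟨m, ⟨r, hr, hmr⟩, hm⟩ := exists_lt_of_lt_csSup hne (sub_lt_self _ hη)
  exact ⟨r, hr, fun x hx hxl =>
    (mul_le_mul_of_nonneg_right hm.le hxl).trans (hmr x hx hxl)⟩

set_option maxHeartbeats 1000000 in
/-- Near `z₀` the optimal linear lower bound is also an upper bound, up to a small error. -/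
lemma LowerComparison.upper_growth {u : Eucl n → ℝ} {z₀ : Eucl n}
    {R₀ M lam C Θ L d : ℝ} (hcomp : LowerComparison u z₀ R₀ M lam C Θ) (hR₀ : 0 < R₀)
    (hS : IsSignoriniAt u z₀ R₀ L) (hlam : 0 < lam) (hC : 0 < C) (hL : 1 ≤ L) (hLM : L + 2 ≤ M)
    (hd : |d| ≤ L) (hd1 : ∀ η > 0, IsLowerSlope u z₀ (d - η))
    (hd2 : ∀ m, IsLowerSlope u z₀ m → m ≤ d) {σ : ℝ} (hσ : 0 < σ) :
    ∃ r₁ > 0, ∀ r, 0 < r → r < r₁ → ∀ x ∈ closedBall z₀ r, 0 ≤ x (Fin.last n) →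
      u x ≤ d * x (Fin.last n) + σ * r := by
  have hL0 : 0 < L := by linarith
  obtain ⟨θ, hθ, hθ1, hθσ⟩ : ∃ θ > 0, θ ≤ 1 ∧ 8 * L * θ ≤ σ := by
    refine ⟨min 1 (σ / (8 * L)), by positivity, min_le_left _ _, ?_⟩
    calc 8 * L * min 1 (σ / (8 * L)) ≤ 8 * L * (σ / (8 * L)) := by
          gcongr
          exact min_le_right _ _
      _ = σ := by field_simp
  obtain ⟨c₁, hc₁, r₁, hr₁, h₁⟩ := hcomp.ellip_propagation hR₀ hS.last hlam hC hL0.le hLM hθ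
    (σ := σ / 4) (by positivity)
  obtain ⟨c₂, hc₂, r₂, hr₂, h₂⟩ := hcomp.ellip_propagation hR₀ hS.last hlam hC hL0.le hLM
    (θ := θ / 2) (by positivity) (σ := c₁ / 2) (by positivity)
  obtain ⟨η, hη, hη1, hηc⟩ : ∃ η > 0, η ≤ 1 ∧ η ≤ c₂ / 4 :=
    ⟨min 1 (c₂ / 4), by positivity, min_le_left _ _, min_le_right _ _⟩
  obtain ⟨r₃, hr₃, h₃⟩ := hd1 η hη
  refine ⟨min (min r₁ r₂) (min (r₃ / 8) (R₀ / 8)), by positivity, fun r hr hrr y hy hyl => ?_⟩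
  simp only [lt_min_iff] at hrr
  obtain ⟨⟨hrr₁, hrr₂⟩, hrr₃, hrR⟩ := hrr
  by_contra! hlt
  rw [mem_closedBall, dist_eq_norm] at hy
  have hym : y ∈ closedBall z₀ R₀ := by
    rw [mem_closedBall, dist_eq_norm]
    linarith
  have hylr : y (Fin.last n) ≤ r := by
    have := abs_apply_le_norm (y - z₀) (Fin.last n)
    rw [PiLp.sub_apply, hS.last, sub_zero] at this
    linarith [le_abs_self (y (Fin.last n))]
  set m := d - η with hm
  have hmL : |m| ≤ L + 1 := (abs_sub _ _).trans (by rw [abs_of_pos hη]; linarith)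
  have hlow : ∀ x ∈ closedBall z₀ (8 * r), 0 ≤ x (Fin.last n) → m * x (Fin.last n) ≤ u x :=
    fun x hx hxl => h₃ x (closedBall_subset_closedBall (by linarith) hx) hxl
  have hθr : θ * r ≤ r := by nlinarith
  have hθr0 : 0 < θ * r := by positivity
  set s := y (Fin.last n) + θ * r with hs
  set y₁ := y + (θ * r) • eLast n with hy₁
  have hy₁l : y₁ (Fin.last n) = s := add_smul_eLast_last _ _
  have hyy₁ : ‖y₁ - y‖ = θ * r := by
    rw [hy₁, add_sub_cancel_left, norm_smul, norm_eLast, mul_one, Real.norm_of_nonneg hθr0.le]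
  have hs0 : 0 < s := by positivity
  have hy₁z : ‖y₁ - z₀‖ ≤ 2 * r := by
    calc ‖y₁ - z₀‖ = ‖(y₁ - y) + (y - z₀)‖ := by congr 1; abel
      _ ≤ ‖y₁ - y‖ + ‖y - z₀‖ := norm_add_le _ _
      _ ≤ 2 * r := by linarith
  have ha0 : (0 : ℝ) < 1 / (16 * r ^ 2) := by positivity
  have hab : 1 / (16 * r ^ 2) ≤ 1 / s ^ 2 := by
    have : s ^ 2 ≤ (4 * r) ^ 2 := by gcongr; linarith
    exact one_div_le_one_div_of_le (by positivity) (by linarith)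
  have g₁ := h₁ r m (1 / (16 * r ^ 2)) s y₁ hr hrr₁ hmL hy₁l (by linarith) (by linarith) le_rfl
    hab hlow (by
      intro x hx hxl
      have hxy : ‖x - y‖ ≤ 2 * (θ * r) := by
        calc ‖x - y‖ = ‖(x - y₁) + (y₁ - y)‖ := by congr 1; abel
          _ ≤ ‖x - y₁‖ + ‖y₁ - y‖ := norm_add_le _ _
          _ ≤ 2 * (θ * r) := by linarith
      have hxm : x ∈ closedBall z₀ R₀ := by
        rw [mem_closedBall, dist_eq_norm]
        calc ‖x - z₀‖ = ‖(x - y) + (y - z₀)‖ := by congr 1; abel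
          _ ≤ ‖x - y‖ + ‖y - z₀‖ := norm_add_le _ _
          _ ≤ R₀ := by linarith
      have i1 := (abs_le.1 (hS.lip x hxm hxl y hym hyl)).1
      have i2 : L * ‖x - y‖ ≤ L * (2 * (θ * r)) := by gcongr
      have i3 : |m * (x (Fin.last n) - y (Fin.last n))| ≤ (2 * L) * (2 * (θ * r)) := by
        rw [abs_mul]
        have := abs_apply_le_norm (x - y) (Fin.last n)
        rw [PiLp.sub_apply] at this
        gcongr
        · linarith
        · linarith
      have i4 := (abs_le.1 i3).2
      have i5 : m * y (Fin.last n) ≤ d * y (Fin.last n) :=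
        mul_le_mul_of_nonneg_right (by linarith) hyl
      have i6 := mul_le_mul_of_nonneg_right hθσ hr.le
      linarith)
  have hstep : IsLowerSlope u z₀ (m + c₂ / 2) := by
    refine ⟨θ * r / 2, by positivity, fun w hw hwl => ?_⟩
    rw [mem_closedBall, dist_eq_norm] at hw
    have hwlr : w (Fin.last n) ≤ θ * r / 2 := by
      have := abs_apply_le_norm (w - z₀) (Fin.last n)
      rw [PiLp.sub_apply, hS.last, sub_zero] at this
      linarith [le_abs_self (w (Fin.last n))]
    set t := w (Fin.last n) with ht
    set y₂ := w + (s - t) • eLast n with hy₂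
    have hst : 0 ≤ s - t := by linarith
    have hy₂l : y₂ (Fin.last n) = s := by
      rw [hy₂, add_smul_eLast_last]
      ring
    have hwy₂ : ‖w - y₂‖ = s - t := by
      rw [hy₂, ← norm_neg, neg_sub, add_sub_cancel_left, norm_smul, norm_eLast, mul_one,
        Real.norm_of_nonneg hst]
    have hy₂z : ‖y₂ - z₀‖ ≤ 4 * r := by
      calc ‖y₂ - z₀‖ = ‖(w - z₀) - (w - y₂)‖ := by congr 1; abel
        _ ≤ ‖w - z₀‖ + ‖w - y₂‖ := norm_sub_le _ _
        _ ≤ 4 * r := by linarith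
    have hy₂y₁ : ‖y₂ - y₁‖ ≤ 3 * r / 2 := by
      have e1 := norm_sub_last_smul_le (w - z₀)
      have e2 := norm_sub_last_smul_le (y - z₀)
      rw [PiLp.sub_apply, hS.last, sub_zero] at e1 e2
      calc ‖y₂ - y₁‖ = ‖(w - z₀ - t • eLast n) - (y - z₀ - y (Fin.last n) • eLast n)‖ := by
            congr 1
            rw [hy₂, hy₁, hs]
            module
        _ ≤ ‖w - z₀ - t • eLast n‖ + ‖y - z₀ - y (Fin.last n) • eLast n‖ := norm_sub_le _ _
        _ ≤ 3 * r / 2 := by linarith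
    have g₂ := h₂ r m (1 / s ^ 2) s y₂ hr hrr₂ hmL hy₂l (by linarith) hy₂z hab le_rfl hlow (by
        intro x hx hxl
        have k1 : ‖x - y₁‖ ≤ 2 * r := by
          calc ‖x - y₁‖ = ‖(x - y₂) + (y₂ - y₁)‖ := by congr 1; abel
            _ ≤ ‖x - y₂‖ + ‖y₂ - y₁‖ := norm_add_le _ _
            _ ≤ 2 * r := by linarith
        have k2 : |x (Fin.last n) - s| ≤ s / 2 := by
          have := abs_apply_le_norm (x - y₂) (Fin.last n)
          rw [PiLp.sub_apply, hy₂l] at this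
          linarith
        have k3 : ellip (1 / (16 * r ^ 2)) (1 / s ^ 2) y₁ x ≤ 1 / 2 := by
          have j1 : 1 / (16 * r ^ 2) * ‖x - y₁‖ ^ 2 ≤ 1 / 4 := by
            calc 1 / (16 * r ^ 2) * ‖x - y₁‖ ^ 2 ≤ 1 / (16 * r ^ 2) * (2 * r) ^ 2 := by gcongr
              _ = 1 / 4 := by field_simp; norm_num
          have j2 : (1 / s ^ 2 - 1 / (16 * r ^ 2)) * (x (Fin.last n) - s) ^ 2 ≤ 1 / 4 := by
            calc (1 / s ^ 2 - 1 / (16 * r ^ 2)) * (x (Fin.last n) - s) ^ 2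
                ≤ 1 / s ^ 2 * |x (Fin.last n) - s| ^ 2 := by
                  rw [sq_abs]
                  gcongr
                  linarith
              _ ≤ 1 / s ^ 2 * (s / 2) ^ 2 := by gcongr
              _ = 1 / 4 := by field_simp; norm_num
          unfold ellip
          rw [hy₁l]
          linarith
        have k4 := g₁ x hxl (by linarith)
        have k5 : c₁ * r * (1 / 2) ≤
            c₁ * r * (1 - ellip (1 / (16 * r ^ 2)) (1 / s ^ 2) y₁ x) := by
          gcongr
          linarith
        linarith) w hwl
    have hq : ellip (1 / s ^ 2) (1 / s ^ 2) y₂ w = (1 - t / s) ^ 2 := by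
      unfold ellip
      rw [hwy₂, sub_self, zero_mul, add_zero]
      field_simp
    have hts : t / s ≤ 1 := (div_le_one hs0).2 (by linarith)
    have hts0 : 0 ≤ t / s := by positivity
    have g₃ := g₂ (by rw [hq]; nlinarith)
    rw [hq] at g₃
    have g₄ : t / (2 * r) ≤ 1 - (1 - t / s) ^ 2 := by
      have : t / (2 * r) ≤ t / s := by
        gcongr
        linarith
      nlinarith
    have g₅ : c₂ / 2 * t ≤ c₂ * r * (1 - (1 - t / s) ^ 2) := by
      calc c₂ / 2 * t = c₂ * r * (t / (2 * r)) := by field_simp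
        _ ≤ _ := by gcongr
    linarith
  have := hd2 _ hstep
  linarith

lemma quadBarrier_bounds {z₀ x y : Eucl n} (hz : z₀ (Fin.last n) = 0) {m t K γ δ r : ℝ}
    (ht : 0 ≤ t) (hr : 0 < r) (hK : 1 ≤ K) (htK : t * (K * r) = δ / 4) (hγ : |γ| ≤ t * r ^ 2)
    (hy : ‖y - z₀‖ ≤ r) (hx : x ∈ closedBall z₀ r) :
    |quadBarrier m t K γ y x| ≤ (|m| + 2 * δ) * r ∧
      ‖quadBarrierGrad m t K y x - m • eLast n‖ ≤ 2 * δ := by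
  rw [mem_closedBall, dist_eq_norm] at hx
  have hxl : |x (Fin.last n)| ≤ r := by
    have := abs_apply_le_norm (x - z₀) (Fin.last n)
    rw [PiLp.sub_apply, hz, sub_zero] at this
    exact this.trans hx
  have hxy : ‖x - y‖ ≤ 2 * r := by
    calc ‖x - y‖ = ‖(x - z₀) - (y - z₀)‖ := by congr 1; abel
      _ ≤ ‖x - z₀‖ + ‖y - z₀‖ := norm_sub_le _ _
      _ ≤ 2 * r := by linarith
  have htr : t * r ≤ δ / 4 := by
    rw [← htK]
    gcongr
    nlinarith
  have htr0 : 0 ≤ t * r := by positivity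
  constructor
  · have h1 : |K * x (Fin.last n) ^ 2 - ‖x - y‖ ^ 2| ≤ K * r ^ 2 + (2 * r) ^ 2 := by
      refine (abs_sub _ _).trans ?_
      rw [abs_mul, abs_pow, abs_pow, abs_norm, abs_of_nonneg (by linarith : 0 ≤ K)]
      gcongr
    calc |quadBarrier m t K γ y x|
        ≤ |m| * |x (Fin.last n)| + t * |K * x (Fin.last n) ^ 2 - ‖x - y‖ ^ 2| + |γ| := by
          refine (abs_add_le _ _).trans (add_le_add_left ((abs_add_le _ _).trans ?_) _)
          rw [abs_mul, abs_mul, abs_of_nonneg ht]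
      _ ≤ |m| * r + t * (K * r ^ 2 + (2 * r) ^ 2) + t * r ^ 2 := by gcongr
      _ = (|m| + t * (K * r) + 5 * (t * r)) * r := by ring
      _ ≤ (|m| + 2 * δ) * r := mul_le_mul_of_nonneg_right (by linarith) hr.le
  · have h1 : ‖(K * x (Fin.last n)) • eLast n - (x - y)‖ ≤ K * r + 2 * r := by
      refine (norm_sub_le _ _).trans ?_
      rw [norm_smul, norm_eLast, mul_one, Real.norm_eq_abs, abs_mul,
        abs_of_nonneg (by linarith : 0 ≤ K)]
      gcongr
    rw [quadBarrierGrad, add_sub_cancel_left, norm_smul,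
      Real.norm_of_nonneg (by positivity : 0 ≤ 2 * t)]
    calc 2 * t * ‖(K * x (Fin.last n)) • eLast n - (x - y)‖
        ≤ 2 * t * (K * r + 2 * r) := by gcongr
      _ = 2 * (t * (K * r)) + 4 * (t * r) := by ring
      _ ≤ 2 * δ := by linarith

lemma isTest_quadBarrier {z₀ y : Eucl n} (hz : z₀ (Fin.last n) = 0) {m t K γ δ r M : ℝ}
    (ht : 0 ≤ t) (hr : 0 < r) (hr1 : r ≤ 1) (hδ : 0 ≤ δ) (hK : 1 ≤ K) (htK : t * (K * r) = δ / 4)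
    (hγ : |γ| ≤ t * r ^ 2) (hy : ‖y - z₀‖ ≤ r) (hM : |m| + 2 * δ ≤ M) :
    IsTest z₀ r M (quadBarrier m t K γ y) (quadBarrierGrad m t K y) where
  grad := hasGradientAt_quadBarrier m t K γ y
  smooth := contDiff_quadBarrierGrad m t K y
  bound x hx := by
    refine (quadBarrier_bounds hz ht hr hK htK hγ hy hx).1.trans ?_
    have : 0 ≤ |m| + 2 * δ := by positivity
    nlinarith
  gradBound x hx := by
    have h := (quadBarrier_bounds hz ht hr hK htK hγ hy hx (m := m)).2
    have h2 := norm_le_norm_sub_add (quadBarrierGrad m t K y x) (m • eLast n)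
    rw [norm_smul, norm_eLast, mul_one, Real.norm_eq_abs] at h2
    linarith

lemma H0.exists_nhd_pos {F : Eucl n → ℝ → Eucl n → Eucl n} {F₀ : Eucl n → ℝ → Eucl n → ℝ}
    (hF : H0 F F₀) {z₀ p₀ : Eucl n} (hz : z₀ ∈ ball (0 : Eucl n) 1) {s : ℝ}
    (h : 0 < s * F z₀ 0 p₀ (Fin.last n)) :
    ∃ ε > 0, ∀ x z p, ‖x - z₀‖ < ε → |z| < ε → ‖p - p₀‖ < ε →
      0 < s * F x z p (Fin.last n) := by
  have hc : ContinuousAt (fun q : Eucl n × ℝ × Eucl n => F q.1 q.2.1 q.2.2) (z₀, 0, p₀) :=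
    hF.1.continuousOn.continuousAt ((isOpen_ball.prod (isOpen_univ.prod isOpen_univ)).mem_nhds
      ⟨hz, Set.mem_univ _, Set.mem_univ _⟩)
  have hc' : ContinuousAt (fun q : Eucl n × ℝ × Eucl n => s * F q.1 q.2.1 q.2.2 (Fin.last n))
      (z₀, 0, p₀) :=
    continuousAt_const.mul ((continuous_last (n := n)).continuousAt.comp hc)
  obtain ⟨ε, hε, hb⟩ := Metric.eventually_nhds_iff.1 (hc'.eventually (lt_mem_nhds h))
  refine ⟨ε, hε, fun x z p hx hz hp => hb (y := (x, z, p)) ?_⟩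
  rw [Prod.dist_eq, Prod.dist_eq, max_lt_iff, max_lt_iff, dist_eq_norm, dist_eq_norm, dist_eq_norm,
    sub_zero]
  exact ⟨hx, hz, hp⟩

/-- The conormal derivative in the direction of the optimal slope is nonpositive. -/
lemma conormal_nonpos {F : Eucl n → ℝ → Eucl n → Eucl n}
    {F₀ : Eucl n → ℝ → Eucl n → ℝ} (hF : H0 F F₀) {u : Eucl n → ℝ} {z₀ : Eucl n}
    (hz₀ : z₀ ∈ ball (0 : Eucl n) 1) {R₀ M lam C Θ L d : ℝ}
    (hcomp : ∀ R φ P, 0 < R → R ≤ R₀ → IsTest z₀ R M φ P →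
      (∀ x : Eucl n, ‖x - z₀‖ = R → 0 ≤ x (Fin.last n) → φ x ≤ u x) →
      (∀ x ∈ closedBall z₀ R, 0 < x (Fin.last n) → u x < φ x →
        PucciGE lam C Θ (fderiv ℝ P x)) →
      (∀ x ∈ closedBall z₀ R, 0 ≤ x (Fin.last n) → 0 ≤ F x (φ x) (P x) (Fin.last n)) →
      ∀ x ∈ closedBall z₀ R, 0 ≤ x (Fin.last n) → φ x ≤ u x)
    (hR₀ : 0 < R₀) (hS : IsSignoriniAt u z₀ R₀ L) (hlam : 0 < lam) (hC : 0 < C)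
    (hL : 1 ≤ L) (hLM : L + 3 ≤ M) (hd : |d| ≤ L) (hd1 : ∀ η > 0, IsLowerSlope u z₀ (d - η)) :
    F z₀ 0 (d • eLast n) (Fin.last n) ≤ 0 := by
  by_contra! hpos
  obtain ⟨ε, hε, hnhd⟩ := hF.exists_nhd_pos hz₀ (s := 1) (by rwa [one_mul])
  simp only [one_mul] at hnhd
  obtain ⟨δ, hδ, hδ1, hδε⟩ : ∃ δ > 0, δ ≤ 1 ∧ δ ≤ ε / 4 :=
    ⟨min 1 (ε / 4), by positivity, min_le_left _ _, min_le_right _ _⟩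
  obtain ⟨r₁, hr₁, hlow⟩ := hd1 (δ / 4) (by positivity)
  obtain ⟨K, hK, hKlam⟩ : ∃ K, 1 ≤ K ∧ 1 ≤ K * lam - (n + 1) * C := by
    refine ⟨1 + ((n + 1) * C + 1) / lam, by
      have : 0 ≤ ((n + 1) * C + 1) / lam := by positivity
      linarith, ?_⟩
    rw [add_mul, div_mul_cancel₀ _ hlam.ne']
    linarith
  have hK0 : 0 < K := by linarith
  obtain ⟨r, hr, hrr₁, hrR, hr1, hrε, hrL, hrΘ⟩ : ∃ r > 0, r ≤ r₁ ∧ r ≤ R₀ ∧ r ≤ 1 ∧ r ≤ ε / 2 ∧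
      (L + 3) * r ≤ ε / 2 ∧ |Θ| * r ≤ δ / (4 * K) := by
    have hL3 : 0 < L + 3 := by linarith
    refine ⟨min (min (min r₁ R₀) (min 1 (ε / 2)))
      (min (ε / 2 / (L + 3)) (δ / (4 * K) / (|Θ| + 1))), by positivity, ?_, ?_, ?_, ?_, ?_, ?_⟩
    · simp
    · simp
    · simp
    · simp
    · rw [mul_comm, ← le_div_iff₀ hL3]
      simp
    · refine le_trans (mul_le_mul_of_nonneg_right (by linarith : |Θ| ≤ |Θ| + 1) (by positivity)) ?_
      rw [mul_comm, ← le_div_iff₀ (by positivity)]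
      simp
  set t := δ / (4 * K * r) with ht
  have ht0 : 0 < t := by positivity
  have htK : t * (K * r) = δ / 4 := by rw [ht]; field_simp
  have hγ : |t * r ^ 2| ≤ t * r ^ 2 := (abs_of_pos (by positivity)).le
  have hzz : ‖z₀ - z₀‖ ≤ r := by simpa using hr.le
  have hmL : |d - δ| ≤ L + 1 := (abs_sub _ _).trans (by rw [abs_of_pos hδ]; linarith)
  have key := hcomp r (quadBarrier (d - δ) t K (t * r ^ 2) z₀) (quadBarrierGrad (d - δ) t K z₀)
    hr hrR (isTest_quadBarrier hS.last ht0.le hr hr1 hδ.le hK htK hγ hzz (by linarith))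
    (fun x hx hxl => ?_) (fun x hx hxl _ => ?_) (fun x hx hxl => ?_) z₀
    (mem_closedBall_self hr.le) hS.last.ge
  · have : quadBarrier (d - δ) t K (t * r ^ 2) z₀ z₀ = t * r ^ 2 := by
      simp [quadBarrier, hS.last]
    rw [this, hS.zero] at key
    exact absurd key (not_le.2 (by positivity))
  · have h1 := hlow x (by rw [mem_closedBall, dist_eq_norm, hx]; exact hrr₁) hxl
    have hxlr : x (Fin.last n) ≤ r := by
      have := abs_apply_le_norm (x - z₀) (Fin.last n)
      rw [PiLp.sub_apply, hS.last, sub_zero] at this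
      linarith [le_abs_self (x (Fin.last n))]
    have h2 : t * (K * x (Fin.last n) ^ 2) ≤ δ / 4 * x (Fin.last n) := by
      calc t * (K * x (Fin.last n) ^ 2) = t * (K * x (Fin.last n)) * x (Fin.last n) := by ring
        _ ≤ t * (K * r) * x (Fin.last n) := by gcongr
        _ = δ / 4 * x (Fin.last n) := by rw [htK]
    have h3 : 0 ≤ δ * x (Fin.last n) := by positivity
    unfold quadBarrier
    rw [hx]
    linarith
  · refine pucciGE_quadBarrier ht0.le hK0.le z₀ x ?_
    have h1 : |Θ| ≤ t := by
      rw [ht, ← div_div, le_div_iff₀ hr]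
      exact hrΘ
    nlinarith [le_abs_self Θ]
  · obtain ⟨b1, b2⟩ := quadBarrier_bounds hS.last ht0.le hr hK htK hγ hzz hx (m := d - δ)
    rw [mem_closedBall, dist_eq_norm] at hx
    refine (hnhd _ _ _ (by linarith) ?_ ?_).le
    · have : (|d - δ| + 2 * δ) * r ≤ (L + 3) * r :=
        mul_le_mul_of_nonneg_right (by linarith) hr.le
      linarith
    · have h2 : ‖(d - δ) • eLast n - d • eLast n‖ = δ := by
        rw [← sub_smul, norm_smul, norm_eLast, mul_one, sub_sub_cancel_left, norm_neg,
          Real.norm_of_nonneg hδ.le]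
      have h3 := norm_sub_le_norm_sub_add_norm_sub (quadBarrierGrad (d - δ) t K z₀ x)
        ((d - δ) • eLast n) (d • eLast n)
      linarith

/-- The conormal derivative in the direction of the optimal slope is nonnegative at a limit of
thin points where `u` is positive. -/
lemma conormal_nonneg {F : Eucl n → ℝ → Eucl n → Eucl n}
    {F₀ : Eucl n → ℝ → Eucl n → ℝ} (hF : H0 F F₀) {u : Eucl n → ℝ} {z₀ : Eucl n}
    (hz₀ : z₀ ∈ ball (0 : Eucl n) 1) {R₀ M lam C Θ L d : ℝ}
    (hcomp : ∀ R φ P, 0 < R → R ≤ R₀ → IsTest z₀ R M φ P →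
      (∀ x : Eucl n, ‖x - z₀‖ = R → 0 ≤ x (Fin.last n) → u x ≤ -φ x) →
      (∀ x ∈ closedBall z₀ R, 0 < x (Fin.last n) → PucciGE lam C Θ (fderiv ℝ P x)) →
      (∀ x ∈ closedBall z₀ R, 0 ≤ x (Fin.last n) → F x (-φ x) (-P x) (Fin.last n) ≤ 0) →
      (∀ x ∈ closedBall z₀ R, x (Fin.last n) = 0 → φ x ≤ 0) →
      ∀ x ∈ closedBall z₀ R, 0 ≤ x (Fin.last n) → u x ≤ -φ x)
    (hR₀ : 0 < R₀) (hS : IsSignoriniAt u z₀ R₀ L) (hlam : 0 < lam) (hC : 0 < C)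
    (hL : 1 ≤ L) (hLM : L + 3 ≤ M) (hd : |d| ≤ L)
    (hup : ∀ σ > 0, ∃ r₁ > 0, ∀ r, 0 < r → r < r₁ → ∀ x ∈ closedBall z₀ r, 0 ≤ x (Fin.last n) →
      u x ≤ d * x (Fin.last n) + σ * r)
    (hfree : ∀ r > 0, ∃ y ∈ ball z₀ r, y (Fin.last n) = 0 ∧ 0 < u y) :
    0 ≤ F z₀ 0 (d • eLast n) (Fin.last n) := by
  by_contra! hneg
  obtain ⟨ε, hε, hnhd⟩ := hF.exists_nhd_pos hz₀ (s := -1) (by rw [neg_one_mul]; linarith)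
  simp only [neg_one_mul, Left.neg_pos_iff] at hnhd
  obtain ⟨δ, hδ, hδ1, hδε⟩ : ∃ δ > 0, δ ≤ 1 ∧ δ ≤ ε / 4 :=
    ⟨min 1 (ε / 4), by positivity, min_le_left _ _, min_le_right _ _⟩
  obtain ⟨K, hK, hKlam⟩ : ∃ K, 1 ≤ K ∧ 1 ≤ K * lam - (n + 1) * C := by
    refine ⟨1 + ((n + 1) * C + 1) / lam, by
      have : 0 ≤ ((n + 1) * C + 1) / lam := by positivity
      linarith, ?_⟩
    rw [add_mul, div_mul_cancel₀ _ hlam.ne']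
    linarith
  have hK0 : 0 < K := by linarith
  obtain ⟨r₁, hr₁, hupp⟩ := hup (δ / (16 * K)) (by positivity)
  obtain ⟨r, hr, hrr₁, hrR, hr1, hrε, hrL, hrΘ⟩ : ∃ r > 0, r < r₁ ∧ r ≤ R₀ ∧ r ≤ 1 ∧ r ≤ ε / 2 ∧
      (L + 3) * r ≤ ε / 2 ∧ |Θ| * r ≤ δ / (4 * K) := by
    have hL3 : 0 < L + 3 := by linarith
    refine ⟨min (min (min (r₁ / 2) R₀) (min 1 (ε / 2)))
      (min (ε / 2 / (L + 3)) (δ / (4 * K) / (|Θ| + 1))), by positivity, ?_, ?_, ?_, ?_, ?_, ?_⟩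
    · exact lt_of_le_of_lt ((min_le_left _ _).trans ((min_le_left _ _).trans (min_le_left _ _)))
        (half_lt_self hr₁)
    · simp
    · simp
    · simp
    · rw [mul_comm, ← le_div_iff₀ hL3]
      simp
    · refine le_trans (mul_le_mul_of_nonneg_right (by linarith : |Θ| ≤ |Θ| + 1) (by positivity)) ?_
      rw [mul_comm, ← le_div_iff₀ (by positivity)]
      simp
  obtain ⟨y, hy, hyl, huy⟩ := hfree (r / 2) (by positivity)
  rw [mem_ball, dist_eq_norm] at hy
  set t := δ / (4 * K * r) with ht
  have ht0 : 0 < t := by positivity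
  have htK : t * (K * r) = δ / 4 := by rw [ht]; field_simp
  have hγ : |(0 : ℝ)| ≤ t * r ^ 2 := by rw [abs_zero]; positivity
  have hyz : ‖y - z₀‖ ≤ r := by linarith
  have hmL : |-(d + δ)| ≤ L + 1 := by
    rw [abs_neg]
    exact (abs_add_le _ _).trans (by rw [abs_of_pos hδ]; linarith)
  have key := hcomp r (quadBarrier (-(d + δ)) t K 0 y) (quadBarrierGrad (-(d + δ)) t K y)
    hr hrR (isTest_quadBarrier hS.last ht0.le hr hr1 hδ.le hK htK hγ hyz (by linarith))
    (fun x hx hxl => ?_) (fun x hx hxl => ?_) (fun x hx hxl => ?_) (fun x hx hxl => ?_) y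
    (by rwa [mem_closedBall, dist_eq_norm]) hyl.ge
  · have : quadBarrier (-(d + δ)) t K 0 y y = 0 := by
      simp [quadBarrier, hyl]
    rw [this] at key
    linarith
  · have h1 := hupp r hr hrr₁ x (by rw [mem_closedBall, dist_eq_norm, hx]) hxl
    have hxlr : x (Fin.last n) ≤ r := by
      have := abs_apply_le_norm (x - z₀) (Fin.last n)
      rw [PiLp.sub_apply, hS.last, sub_zero] at this
      linarith [le_abs_self (x (Fin.last n))]
    have h2 : t * (K * x (Fin.last n) ^ 2) ≤ δ / 4 * x (Fin.last n) := by
      calc t * (K * x (Fin.last n) ^ 2) = t * (K * x (Fin.last n)) * x (Fin.last n) := by ring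
        _ ≤ t * (K * r) * x (Fin.last n) := by gcongr
        _ = δ / 4 * x (Fin.last n) := by rw [htK]
    have h3 : 0 ≤ δ * x (Fin.last n) := by positivity
    have h4 : r / 2 ≤ ‖x - y‖ := by
      have : ‖x - z₀‖ ≤ ‖x - y‖ + ‖y - z₀‖ := by
        calc ‖x - z₀‖ = ‖(x - y) + (y - z₀)‖ := by congr 1; abel
          _ ≤ _ := norm_add_le _ _
      linarith
    have h5 : δ / (16 * K) * r ≤ t * ‖x - y‖ ^ 2 := by
      calc δ / (16 * K) * r = t * (r / 2) ^ 2 := by rw [ht]; field_simp; norm_num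
        _ ≤ _ := by gcongr
    unfold quadBarrier
    linarith
  · refine pucciGE_quadBarrier ht0.le hK0.le y x ?_
    have h1 : |Θ| ≤ t := by
      rw [ht, ← div_div, le_div_iff₀ hr]
      exact hrΘ
    nlinarith [le_abs_self Θ]
  · obtain ⟨b1, b2⟩ := quadBarrier_bounds hS.last ht0.le hr hK htK hγ hyz hx (m := -(d + δ))
    rw [mem_closedBall, dist_eq_norm] at hx
    refine (hnhd _ _ _ (by linarith) ?_ ?_).le
    · have : (|-(d + δ)| + 2 * δ) * r ≤ (L + 3) * r :=
        mul_le_mul_of_nonneg_right (by linarith) hr.le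
      rw [abs_neg]
      linarith
    · have h2 : ‖-(d + δ) • eLast n - -(d • eLast n)‖ = δ := by
        rw [← neg_smul, ← sub_smul, norm_smul, norm_eLast, mul_one, neg_add', sub_sub_cancel_left,
          norm_neg, Real.norm_of_nonneg hδ.le]
      have h3 := norm_sub_le_norm_sub_add_norm_sub (quadBarrierGrad (-(d + δ)) t K y x)
        (-(d + δ) • eLast n) (-(d • eLast n))
      rw [show -quadBarrierGrad (-(d + δ)) t K y x - d • eLast n =
        -(quadBarrierGrad (-(d + δ)) t K y x - -(d • eLast n)) by abel, norm_neg]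
      linarith
  · have : 0 ≤ t * ‖x - y‖ ^ 2 := by positivity
    unfold quadBarrier
    rw [hxl]
    linarith

lemma tendsto_div_of_slope {u : Eucl n → ℝ} {z₀ : Eucl n} {d : ℝ} (hz : z₀ (Fin.last n) = 0)
    (hd1 : ∀ η > 0, IsLowerSlope u z₀ (d - η))
    (hup : ∀ σ > 0, ∃ r₁ > 0, ∀ r, 0 < r → r < r₁ → ∀ x ∈ closedBall z₀ r, 0 ≤ x (Fin.last n) →
      u x ≤ d * x (Fin.last n) + σ * r) :
    Tendsto (fun t : ℝ => u (z₀ + t • eLast n) / t) (𝓝[>] (0 : ℝ)) (𝓝 d) := by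
  rw [Metric.tendsto_nhds]
  intro ε hε
  obtain ⟨r₁, hr₁, h₁⟩ := hd1 (ε / 2) (by positivity)
  obtain ⟨r₂, hr₂, h₂⟩ := hup (ε / 2) (by positivity)
  filter_upwards [Ioo_mem_nhdsGT (lt_min hr₁ hr₂)] with t ht
  obtain ⟨ht0, ht1⟩ := ht
  rw [lt_min_iff] at ht1
  have hl : (z₀ + t • eLast n) (Fin.last n) = t := by rw [add_smul_eLast_last, hz, zero_add]
  have e1 := h₁ _ (add_smul_eLast_mem ht0.le ht1.1.le) (hl.symm ▸ ht0.le)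
  have e2 := h₂ t ht0 ht1.2 _ (add_smul_eLast_mem ht0.le le_rfl) (hl.symm ▸ ht0.le)
  rw [hl] at e1 e2
  have e3 : d - ε / 2 ≤ u (z₀ + t • eLast n) / t := (le_div_iff₀ ht0).2 e1
  have e4 : u (z₀ + t • eLast n) / t ≤ d + ε / 2 := (div_le_iff₀ ht0).2 (by linarith)
  rw [Real.dist_eq, abs_lt]
  constructor <;> linarith

end TOP

open TOP in
/-- Proposition: Signorini condition at free boundary points.
For a Lipschitz solution of the boundary obstacle problem, at every free boundary
point `z₀` the one-sided normal derivative `∂_{n+1}u(z₀) = lim_{t→0⁺} u(z₀ + t e_{n+1})/t`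
exists and `F_{n+1}(z₀, 0, (0, ∂_{n+1}u(z₀))) = 0`. -/
theorem conormal_vanishes_on_free_boundary {n : ℕ}
    (F : Eucl n → ℝ → Eucl n → Eucl n) (F₀ : Eucl n → ℝ → Eucl n → ℝ)
    (g u : Eucl n → ℝ)
    (hF : H0 F F₀) (hell : H1 F)
    (hu : BdrySolution F F₀ g u) :
    ∀ z₀ ∈ freeBoundary u, ∃ d : ℝ,
      Filter.Tendsto (fun t : ℝ => u (z₀ + t • eLast n) / t) (𝓝[>] (0 : ℝ)) (nhds d) ∧
      F z₀ 0 (d • eLast n) (Fin.last n) = 0 := by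
  intro z₀ hz₀
  obtain ⟨⟨⟨hball, hlast⟩, hzero⟩, hfree⟩ := hz₀
  replace hlast : z₀ (Fin.last n) = 0 := hlast
  obtain ⟨⟨L₀, hL₀⟩, -, hthin⟩ := hu.1
  have hnorm : ‖z₀‖ < 1 := mem_ball_zero_iff.1 hball
  have hL : LipschitzOnWith (max L₀ 1) u (closedBall 0 1 ∩ {x | 0 ≤ x (Fin.last n)}) :=
    hL₀.weaken (le_max_left _ _)
  have hL1 : (1 : ℝ) ≤ (max L₀ 1 : ℝ≥0) := by exact_mod_cast le_max_right L₀ 1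
  generalize max L₀ 1 = L at hL hL1
  obtain ⟨R₀, hR₀, hR⟩ : ∃ R₀ > 0, ‖z₀‖ + R₀ < 1 := ⟨(1 - ‖z₀‖) / 2, by linarith, by linarith⟩
  have hS : IsSignoriniAt u z₀ R₀ L :=
    { last := hlast
      zero := hzero
      lip := fun x hx hxl y hy hyl => by
        have := hL.dist_le_mul x ⟨ball_subset_closedBall (ball_subset_unit hR hx), hxl⟩ y
          ⟨ball_subset_closedBall (ball_subset_unit hR hy), hyl⟩
        rwa [Real.dist_eq, dist_eq_norm] at this
      nonneg := fun x hx hxl => hthin x ⟨ball_subset_unit hR hx, hxl⟩ }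
  obtain ⟨lam, C, Θ, hlam, hC, hsub⟩ := hu.le_of_subsolution hF hell hlast hzero hR
    (M := L + 3) (by linarith) hL (by linarith)
  obtain ⟨lam', C', Θ', hlam', hC', hsup⟩ := hu.ge_of_supersolution hF hell hlast hzero hR
    (M := L + 3) (by linarith) hL (by linarith)
  have hcomp : LowerComparison u z₀ R₀ (L + 3) lam C Θ :=
    fun R φ P h1 h2 h3 h4 h5 h6 => hsub R φ P h1 h2 h3 h4 h5 (Or.inr h6)
  obtain ⟨d, hd, hd1, hd2⟩ := hS.exists_slope hR₀
  have hup := fun σ (hσ : σ > 0) =>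
    hcomp.upper_growth hR₀ hS hlam hC hL1 (by linarith) hd hd1 hd2 hσ
  refine ⟨d, tendsto_div_of_slope hlast hd1 hup, le_antisymm ?_ ?_⟩
  · exact conormal_nonpos hF hball
      (fun R φ P h1 h2 h3 h4 h5 h6 => hsub R φ P h1 h2 h3 h4 h5 (Or.inl h6))
      hR₀ hS hlam hC hL1 le_rfl hd hd1
  · refine conormal_nonneg hF hball hsup hR₀ hS hlam' hC' hL1 le_rfl hd hup fun r hr => ?_
    obtain ⟨y, hy, hyr, huy⟩ := hfree r hr
    exact ⟨y, hyr, hy.2, huy⟩
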